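/- arXiv:math/0112155 — 2 statements merged into one kernel-verified Lean document; each statement's English description precedes it below -/
import Mathlib

section
/- The two-sided ideal I of B = O_q(Gr(r,N)) generated by {z_kl : k ≤ r or l ≤ r} equals the augmentation ideal B⁺ = B ∩ ker ε. -/
noncomputable section

open scoped TensorProduct

/-- The entries `R̂^{ij}_{kl}` of the `R̂`-matrix of the vector representation of
`U_q(sl_N)`:  `R̂^{ij}_{kl} = q^{δ_{ij}} δ_{il} δ_{jk} + (q - q⁻¹) θ(i<j) δ_{ik} δ_{jl}`. -/
def Rhat (q : ℝ) (i j k l : ℕ) : ℂ :=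
  (if i = l ∧ j = k then (q : ℂ) ^ (if i = j then (1 : ℤ) else 0) else 0) +
  (if i = k ∧ j = l ∧ i < j then ((q : ℂ) - (q : ℂ)⁻¹) else 0)

/-- The defining relations of the quantum Grassmannian `O_q(Gr(r,N))` for a candidate
family of generators `z_{ij}`: the reflection-equation relations, the trace relation
`Σ_i z_{ii} = (1 - q^{-2s})/(q - q⁻¹)` (`s = N - r`), and the projector relation
`q^{2N+1} Σ_n q^{-2n} z_{in} z_{nk} = z_{ik}`. -/
def GrassRels (q : ℝ) (N r : ℕ) {V : Type} [Ring V] [Algebra ℂ V]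
    (z : ℕ → ℕ → V) : Prop :=
  (∀ a ∈ Finset.Icc 1 N, ∀ b ∈ Finset.Icc 1 N, ∀ c ∈ Finset.Icc 1 N, ∀ d ∈ Finset.Icc 1 N,
    (∑ i ∈ Finset.Icc 1 N, ∑ j ∈ Finset.Icc 1 N, ∑ k ∈ Finset.Icc 1 N, ∑ l ∈ Finset.Icc 1 N,
      ((q : ℂ) ^ (2 * (b : ℤ) - 2 * (j : ℤ)) * Rhat q k b j l * Rhat q i l c d) •
        (z i j * z k a)) =
    (∑ i ∈ Finset.Icc 1 N, ∑ j ∈ Finset.Icc 1 N, ∑ k ∈ Finset.Icc 1 N, ∑ l ∈ Finset.Icc 1 N,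
      ((q : ℂ) ^ (2 * (l : ℤ) - 2 * (i : ℤ)) * Rhat q j l i d * Rhat q a b k l) •
        (z c i * z j k))) ∧
  ((∑ i ∈ Finset.Icc 1 N, z i i) =
    algebraMap ℂ V ((1 - (q : ℂ) ^ (-(2 : ℤ) * ((N : ℤ) - (r : ℤ)))) /
      ((q : ℂ) - (q : ℂ)⁻¹))) ∧
  (∀ i ∈ Finset.Icc 1 N, ∀ k ∈ Finset.Icc 1 N,
    ((q : ℂ) ^ (2 * (N : ℤ) + 1)) •
        ∑ n ∈ Finset.Icc 1 N, ((q : ℂ) ^ (-(2 : ℤ) * (n : ℤ))) • (z i n * z n k) =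
      z i k)

/-- The quantum Grassmannian `B = O_q(Gr(r,N))`, presented by the generators `z_{ij}`
(`i,j = 1,…,N`) and the relations `GrassRels`, together with its counit. -/
structure QGrassData (q : ℝ) (N r : ℕ) where
  B : Type
  [instRing : Ring B]
  [instAlg : Algebra ℂ B]
  z : ℕ → ℕ → B
  rels : GrassRels q N r z
  counit : B →ₐ[ℂ] ℂ
  counit_z : ∀ i ∈ Finset.Icc 1 N, ∀ j ∈ Finset.Icc 1 N,
    counit (z i j) = if i = j ∧ r < i then (q : ℂ) ^ (2 * (i : ℤ) - (2 * (N : ℤ) + 1)) else 0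
  gen : Algebra.adjoin ℂ
      {x : B | ∃ i ∈ Finset.Icc 1 N, ∃ j ∈ Finset.Icc 1 N, x = z i j} = ⊤
  univ : ∀ (V : Type) [Ring V] [Algebra ℂ V] (w : ℕ → ℕ → V), GrassRels q N r w →
      ∃ φ : B →ₐ[ℂ] V, ∀ i ∈ Finset.Icc 1 N, ∀ j ∈ Finset.Icc 1 N, φ (z i j) = w i j

attribute [instance] QGrassData.instRing QGrassData.instAlg

namespace QGrassData

variable {q : ℝ} {N r : ℕ} (G : QGrassData q N r)

/-- The augmentation ideal `B⁺ = B ∩ ker ε`, as a `ℂ`-subspace of `B`. -/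
def Bp : Submodule ℂ G.B := LinearMap.ker G.counit.toLinearMap

end QGrassData

/-- The Jucys–Murphy elements `JM 0 = X`, `JM (p+1) = R p * JM p * R p`. -/
def jucysMurphy {E : Type*} [Ring E] (R : ℕ → E) (X : E) : ℕ → E
  | 0 => X
  | p + 1 => R p * jucysMurphy R X p * R p

/-- The product of the first `m` Jucys–Murphy elements. -/
def jucysMurphyProd {E : Type*} [Ring E] (R : ℕ → E) (X : E) : ℕ → E
  | 0 => 1
  | m + 1 => jucysMurphyProd R X m * jucysMurphy R X m

/-- The relations of the affine braid group satisfied by `R 0, R 1, …` and `X`. -/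
structure AffineBraidRels {E : Type*} [Ring E] (R : ℕ → E) (X : E) : Prop where
  comm_X : ∀ p, Commute (R (p + 1)) X
  far : ∀ p p', p + 2 ≤ p' → Commute (R p) (R p')
  braid : ∀ p, R p * R (p + 1) * R p = R (p + 1) * R p * R (p + 1)
  reflection : R 0 * X * R 0 * X = X * R 0 * X * R 0

namespace AffineBraidRels

variable {E : Type*} [Ring E] {R : ℕ → E} {X : E}

theorem commute_jucysMurphy_of_lt (h : AffineBraidRels R X) {i j : ℕ} (hij : j < i) :
    Commute (R i) (jucysMurphy R X j) := by
  induction j with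
  | zero =>
    obtain ⟨i, rfl⟩ := Nat.exists_eq_succ_of_ne_zero hij.ne'
    exact h.comm_X i
  | succ j ih =>
    have hR : Commute (R i) (R j) := (h.far j i hij).symm
    exact (hR.mul_right (ih (by omega))).mul_right hR

theorem commute_jucysMurphy_of_succ_lt (h : AffineBraidRels R X) {i j : ℕ} (hij : i + 1 < j) :
    Commute (R i) (jucysMurphy R X j) := by
  induction j, hij using Nat.le_induction with
  | base =>
    have hc := (h.commute_jucysMurphy_of_lt (Nat.lt_succ_self i)).eq
    have hb := h.braid i
    change R i * (R (i + 1) * (R i * jucysMurphy R X i * R i) * R (i + 1)) =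
      (R (i + 1) * (R i * jucysMurphy R X i * R i) * R (i + 1)) * R i
    generalize jucysMurphy R X i = J at hc
    calc R i * (R (i + 1) * (R i * J * R i) * R (i + 1))
        = (R i * R (i + 1) * R i) * J * R i * R (i + 1) := by noncomm_ring
      _ = R (i + 1) * R i * (R (i + 1) * J) * R i * R (i + 1) := by rw [hb]; noncomm_ring
      _ = R (i + 1) * R i * J * (R (i + 1) * R i * R (i + 1)) := by
        rw [show R (i + 1) * J = J * R (i + 1) from hc]; noncomm_ring
      _ = _ := by rw [← hb]; noncomm_ring
  | succ j hij ih =>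
    have hR : Commute (R i) (R j) := h.far i j hij
    exact (hR.mul_right ih).mul_right hR

theorem commute_X_jucysMurphy (h : AffineBraidRels R X) (j : ℕ) :
    Commute X (jucysMurphy R X j) := by
  induction j with
  | zero => exact Commute.refl X
  | succ j ih =>
    cases j with
    | zero =>
      change X * (R 0 * X * R 0) = R 0 * X * R 0 * X
      rw [h.reflection]; noncomm_ring
    | succ j =>
      have hR := (h.comm_X j).symm
      exact (hR.mul_right ih).mul_right hR

theorem commute_jucysMurphy (h : AffineBraidRels R X) (i j : ℕ) :
    Commute (jucysMurphy R X i) (jucysMurphy R X j) := by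
  wlog hij : i ≤ j generalizing i j
  · exact (this j i (by omega)).symm
  obtain rfl | hij := hij.eq_or_lt
  · exact Commute.refl _
  induction i with
  | zero => exact h.commute_X_jucysMurphy j
  | succ i ih =>
    have hR := h.commute_jucysMurphy_of_succ_lt hij
    exact (hR.mul_left (ih (by omega) (by omega))).mul_left hR

theorem commute_jucysMurphyProd (h : AffineBraidRels R X) (i m : ℕ) :
    Commute (jucysMurphy R X i) (jucysMurphyProd R X m) := by
  induction m with
  | zero => exact Commute.one_right _
  | succ m ih => exact ih.mul_right (h.commute_jucysMurphy i m)

theorem commute_prod_of_le (h : AffineBraidRels R X) {i m : ℕ} (hm : m ≤ i) :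
    Commute (R i) (jucysMurphyProd R X m) := by
  induction m with
  | zero => exact Commute.one_right _
  | succ m ih => exact (ih (by omega)).mul_right (h.commute_jucysMurphy_of_lt (by omega))

theorem commute_mul_succ (h : AffineBraidRels R X) (i : ℕ) :
    Commute (R i) (jucysMurphy R X i * jucysMurphy R X (i + 1)) := by
  have hc := (h.commute_jucysMurphy i (i + 1)).eq
  calc R i * (jucysMurphy R X i * jucysMurphy R X (i + 1))
      = (R i * jucysMurphy R X i * R i) * jucysMurphy R X i * R i := by
        simp only [jucysMurphy]; noncomm_ring
    _ = (jucysMurphy R X (i + 1) * jucysMurphy R X i) * R i := rfl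
    _ = _ := by rw [hc]

theorem commute_prod_of_succ_lt (h : AffineBraidRels R X) {i m : ℕ} (hm : i + 1 < m) :
    Commute (R i) (jucysMurphyProd R X m) := by
  induction m, hm using Nat.le_induction with
  | base =>
    change Commute _ (jucysMurphyProd R X i * jucysMurphy R X i * jucysMurphy R X (i + 1))
    rw [mul_assoc]
    exact (h.commute_prod_of_le le_rfl).mul_right (h.commute_mul_succ i)
  | succ m hm ih => exact ih.mul_right (h.commute_jucysMurphy_of_succ_lt hm)

theorem commute_sum_jucysMurphy [Algebra ℂ E] (h : AffineBraidRels R X) {c : ℂ}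
    (hR : ∀ p, R p * R p = c • R p + 1) {i s : ℕ} (hi : i + 1 < s) :
    Commute (R i) (∑ j ∈ Finset.range s, jucysMurphy R X j) := by
  induction s, hi using Nat.le_induction with
  | base =>
    rw [Finset.sum_range_succ, Finset.sum_range_succ, add_assoc]
    refine Commute.add_right (Commute.sum_right _ _ _ fun j hj =>
      h.commute_jucysMurphy_of_lt (Finset.mem_range.mp hj)) ?_
    simp only [jucysMurphy]
    generalize jucysMurphy R X i = J
    calc R i * (J + R i * J * R i) = R i * J + (R i * R i) * J * R i := by noncomm_ring
      _ = J * R i + R i * J * (R i * R i) := by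
        rw [hR]
        simp only [add_mul, mul_add, smul_mul_assoc, mul_smul_comm, one_mul, mul_one, mul_assoc]
        abel
      _ = _ := by noncomm_ring
  | succ s hs ih =>
    rw [Finset.sum_range_succ]
    exact ih.add_right (h.commute_jucysMurphy_of_succ_lt hs)

theorem X_mul_prod_succ (hX : X * X = X) (m : ℕ) :
    X * jucysMurphyProd R X (m + 1) = jucysMurphyProd R X (m + 1) := by
  induction m with
  | zero => simpa [jucysMurphyProd, jucysMurphy] using hX
  | succ m ih => rw [jucysMurphyProd, ← mul_assoc, ih]

section Module

variable {M : Type*} [AddCommGroup M] [Module ℂ M] {R : ℕ → Module.End ℂ M} {X : Module.End ℂ M}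

theorem jucysMurphy_prod_apply_of_lt (h : AffineBraidRels R X) (hX : X * X = X) {ν : ℂ} {s : ℕ}
    {ω : M} (hω : ∀ p, p + 1 < s → R p ω = ν • ω) {i m : ℕ} (him : i < m) (hms : m ≤ s) :
    jucysMurphy R X i (jucysMurphyProd R X m ω) = (ν ^ 2) ^ i • jucysMurphyProd R X m ω := by
  induction i with
  | zero =>
    obtain ⟨m, rfl⟩ := Nat.exists_eq_succ_of_ne_zero him.ne'
    simpa [jucysMurphy] using LinearMap.congr_fun (X_mul_prod_succ (R := R) hX m) ω
  | succ i ih =>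
    have hR : R i (jucysMurphyProd R X m ω) = ν • jucysMurphyProd R X m ω := by
      rw [← Module.End.mul_apply, (h.commute_prod_of_succ_lt him).eq, Module.End.mul_apply,
        hω i (by omega), map_smul]
    simp only [jucysMurphy, Module.End.mul_apply, hR, map_smul, ih (by omega), smul_smul]
    congr 1
    ring

/-- If the sum of the Jucys–Murphy elements takes its extreme eigenvalue on an
antisymmetric vector, then the idempotent `X` fixes that vector. -/
theorem X_apply_eq_self (h : AffineBraidRels R X) (hX : X * X = X) {ν : ℂ} {s : ℕ} (hs : 0 < s)
    {ω : M} (hω : ∀ p, p + 1 < s → R p ω = ν • ω)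
    (hν : ∀ m < s, ∑ i ∈ Finset.Ico m s, (ν ^ 2) ^ i ≠ 0)
    (hsum : (∑ i ∈ Finset.range s, jucysMurphy R X i) ω =
      (∑ i ∈ Finset.range s, (ν ^ 2) ^ i) • ω) : X ω = ω := by
  let L : Submodule ℂ M :=
    (⨅ p : {p // p + 1 < s}, LinearMap.ker (R p - ν • 1)) ⊓ LinearMap.ker (X - 1)
  have hL : ∀ v, v ∈ L ↔ (∀ p, p + 1 < s → R p v = ν • v) ∧ X v = v := by
    intro v
    simp [L, Submodule.mem_iInf, sub_eq_zero]
  suffices H : ∀ m ≤ s, jucysMurphyProd R X m ω ∈ L from ((hL _).mp (H 0 (by omega))).2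
  intro m hm
  induction hm using Nat.decreasingInduction with
  | self =>
    refine (hL _).mpr ⟨fun p hp => ?_, ?_⟩
    · rw [← Module.End.mul_apply, (h.commute_prod_of_succ_lt hp).eq, Module.End.mul_apply,
        hω p hp, map_smul]
    · obtain ⟨s, rfl⟩ := Nat.exists_eq_succ_of_ne_zero hs.ne'
      exact LinearMap.congr_fun (X_mul_prod_succ (R := R) hX s) ω
  | of_succ m hm ih =>
    have hi : ∀ i, m ≤ i → i < s → jucysMurphy R X i (jucysMurphyProd R X m ω) ∈ L := by
      intro i hmi
      induction i, hmi using Nat.le_induction with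
      | base =>
        intro _
        rw [← Module.End.mul_apply, (h.commute_jucysMurphyProd m m).eq]
        exact ih
      | succ i hmi ihi =>
        intro his
        have hR : R i (jucysMurphyProd R X m ω) = ν • jucysMurphyProd R X m ω := by
          rw [← Module.End.mul_apply, (h.commute_prod_of_le hmi).eq, Module.End.mul_apply,
            hω i (by omega), map_smul]
        have hmem := ihi (by omega)
        simp only [jucysMurphy, Module.End.mul_apply, hR, map_smul,
          ((hL _).mp hmem).1 i (by omega)]
        exact L.smul_mem _ (L.smul_mem _ hmem)
    have hJ : (∑ i ∈ Finset.range s, jucysMurphy R X i) (jucysMurphyProd R X m ω) =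
        (∑ i ∈ Finset.range s, (ν ^ 2) ^ i) • jucysMurphyProd R X m ω := by
      rw [← Module.End.mul_apply,
        (Commute.sum_left _ _ _ fun i _ => h.commute_jucysMurphyProd i m).eq,
        Module.End.mul_apply, hsum, map_smul]
    rw [LinearMap.sum_apply, ← Finset.sum_range_add_sum_Ico _ hm.le,
      Finset.sum_congr rfl fun i hi => h.jucysMurphy_prod_apply_of_lt hX hω
        (Finset.mem_range.mp hi) hm.le, ← Finset.sum_smul,
      ← Finset.sum_range_add_sum_Ico (fun i => (ν ^ 2) ^ i) hm.le, add_smul, add_right_inj] at hJ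
    rw [← L.smul_mem_iff (hν m hm), ← hJ]
    exact L.sum_mem fun i hi' => hi i (Finset.mem_Ico.mp hi').1 (Finset.mem_Ico.mp hi').2

end Module

end AffineBraidRels

section Tensor

variable {n : ℕ} {V : Type*} [Ring V] [Algebra ℂ V]

/-- The `R̂`-matrix acting in the tensor positions `p`, `p + 1`. -/
noncomputable def braidOp (q : ℂ) (n : ℕ) (V : Type*) [Ring V] [Algebra ℂ V] (p : ℕ) :
    Module.End ℂ ((ℕ → Fin n) → V) where
  toFun f c := (if c p = c (p + 1) then q else 1) • f (c ∘ Equiv.swap p (p + 1)) +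
    (if c p < c (p + 1) then q - q⁻¹ else 0) • f c
  map_add' f g := by ext c; simp only [Pi.add_apply, smul_add]; abel
  map_smul' a f := by
    ext c
    simp only [Pi.smul_apply, RingHom.id_apply, smul_add, smul_comm a]

theorem braidOp_apply (q : ℂ) (p : ℕ) (f : (ℕ → Fin n) → V) (c : ℕ → Fin n) :
    braidOp q n V p f c = (if c p = c (p + 1) then q else 1) • f (c ∘ Equiv.swap p (p + 1)) +
      (if c p < c (p + 1) then q - q⁻¹ else 0) • f c := rfl

/-- Multiplication by the matrix `x` in tensor position `0`. -/
def leftOp (x : Fin n → Fin n → V) : Module.End ℂ ((ℕ → Fin n) → V) where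
  toFun f c := ∑ j, x (c 0) j * f (Function.update c 0 j)
  map_add' f g := by ext c; simp [mul_add, Finset.sum_add_distrib]
  map_smul' a f := by ext c; simp [Finset.smul_sum]

theorem leftOp_apply (x : Fin n → Fin n → V) (f : (ℕ → Fin n) → V) (c : ℕ → Fin n) :
    leftOp x f c = ∑ j, x (c 0) j * f (Function.update c 0 j) := rfl

theorem braidOp_mul_self {q : ℂ} (hq : q ≠ 0) (p : ℕ) :
    braidOp q n V p * braidOp q n V p = (q - q⁻¹) • braidOp q n V p + 1 := by
  ext1 f
  funext c
  have hs : (c ∘ Equiv.swap p (p + 1)) ∘ Equiv.swap p (p + 1) = c := by ext; simp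
  simp only [Module.End.mul_apply, LinearMap.add_apply, LinearMap.smul_apply, Pi.add_apply,
    Pi.smul_apply, Module.End.one_apply, braidOp_apply, hs]
  simp only [Function.comp_apply, Equiv.swap_apply_left, Equiv.swap_apply_right]
  rcases lt_trichotomy (c p) (c (p + 1)) with h | h | h
  · simp only [h, h.ne, h.ne', h.not_gt, if_true, if_false]
    module
  · have hc : c ∘ Equiv.swap p (p + 1) = c := by
      ext i
      simp only [Function.comp_apply, Equiv.swap_apply_def]
      split_ifs <;> simp_all
    simp only [h, hc, lt_irrefl, if_true, if_false]
    match_scalars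
    field_simp
    ring
  · simp only [h, h.ne, h.ne', h.not_gt, if_true, if_false]
    module

theorem braidOp_commute (q : ℂ) {p p' : ℕ} (hp : p + 2 ≤ p') :
    Commute (braidOp q n V p) (braidOp q n V p') := by
  refine LinearMap.ext fun f => funext fun c => ?_
  have hs : (c ∘ Equiv.swap p' (p' + 1)) ∘ Equiv.swap p (p + 1) =
      (c ∘ Equiv.swap p (p + 1)) ∘ Equiv.swap p' (p' + 1) := by
    ext i
    simp only [Function.comp_apply, Equiv.swap_apply_def]
    congr 2
    split_ifs <;> omega
  have h1 : Equiv.swap p (p + 1) p' = p' := Equiv.swap_apply_of_ne_of_ne (by omega) (by omega)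
  have h2 : Equiv.swap p (p + 1) (p' + 1) = p' + 1 :=
    Equiv.swap_apply_of_ne_of_ne (by omega) (by omega)
  have h3 : Equiv.swap p' (p' + 1) p = p := Equiv.swap_apply_of_ne_of_ne (by omega) (by omega)
  have h4 : Equiv.swap p' (p' + 1) (p + 1) = p + 1 :=
    Equiv.swap_apply_of_ne_of_ne (by omega) (by omega)
  simp only [Module.End.mul_apply, braidOp_apply, hs]
  simp only [Function.comp_apply, h1, h2, h3, h4]
  module

theorem braidOp_braid {q : ℂ} (hq : q ≠ 0) (p : ℕ) :
    braidOp q n V p * braidOp q n V (p + 1) * braidOp q n V p =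
      braidOp q n V (p + 1) * braidOp q n V p * braidOp q n V (p + 1) := by
  refine LinearMap.ext fun f => funext fun c => ?_
  let u : Fin n → Fin n → Fin n → ℕ → Fin n := fun x y z i =>
    if i = p then x else if i = p + 1 then y else if i = p + 2 then z else c i
  have hc : c = u (c p) (c (p + 1)) (c (p + 2)) := by
    ext i
    simp only [u]
    split_ifs <;> simp_all
  have h0 : ∀ x y z, u x y z p = x := fun x y z => by simp [u]
  have h1 : ∀ x y z, u x y z (p + 1) = y := fun x y z => by simp [u]
  have h2 : ∀ x y z, u x y z (p + 1 + 1) = z := fun x y z => by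
    simp only [u]
    split_ifs <;> first | rfl | omega
  have hs : ∀ x y z, u x y z ∘ Equiv.swap p (p + 1) = u y x z := fun x y z => by
    ext i
    simp only [u, Function.comp_apply, Equiv.swap_apply_def]
    split_ifs <;> first | rfl | omega
  have hs' : ∀ x y z, u x y z ∘ Equiv.swap (p + 1) (p + 1 + 1) = u x z y := fun x y z => by
    ext i
    simp only [u, Function.comp_apply, Equiv.swap_apply_def]
    split_ifs <;> first | rfl | omega
  rw [hc]
  generalize c p = x
  generalize c (p + 1) = y
  generalize c (p + 2) = z
  simp only [Module.End.mul_apply, braidOp_apply, h0, h1, h2, hs, hs']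
  rcases lt_trichotomy x y with h | h | h <;> rcases lt_trichotomy y z with h' | h' | h' <;>
    rcases lt_trichotomy x z with h'' | h'' | h'' <;>
    first
    | (exfalso; order)
    | (subst_vars
       simp only [lt_irrefl, *, ne_of_lt, ne_of_gt, not_lt_of_gt, if_true, if_false] <;>
         match_scalars <;> field_simp <;> ring)

theorem commute_braidOp_leftOp (q : ℂ) (x : Fin n → Fin n → V) (p : ℕ) :
    Commute (braidOp q n V (p + 1)) (leftOp x) := by
  refine LinearMap.ext fun f => funext fun c => ?_
  have h0 : Equiv.swap (p + 1) (p + 1 + 1) 0 = 0 :=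
    Equiv.swap_apply_of_ne_of_ne (by omega) (by omega)
  have hs : ∀ j, Function.update c 0 j ∘ Equiv.swap (p + 1) (p + 1 + 1) =
      Function.update (c ∘ Equiv.swap (p + 1) (p + 1 + 1)) 0 j := fun j => by
    ext i
    have hi : Equiv.swap (p + 1) (p + 1 + 1) i = 0 ↔ i = 0 := by
      rw [← h0, Equiv.apply_eq_iff_eq, h0]
    simp only [Function.comp_apply, Function.update_apply, hi]
  simp only [Module.End.mul_apply, braidOp_apply, leftOp_apply, hs]
  simp [h0, Finset.smul_sum, mul_add, Finset.sum_add_distrib]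

theorem leftOp_mul_self {x : Fin n → Fin n → V} (hx : ∀ i k, ∑ j, x i j * x j k = x i k) :
    leftOp x * leftOp x = leftOp x := by
  refine LinearMap.ext fun f => funext fun c => ?_
  simp only [Module.End.mul_apply, leftOp_apply, Function.update_self, Function.update_idem,
    Finset.mul_sum]
  rw [Finset.sum_comm]
  simp only [← mul_assoc, ← Finset.sum_mul, hx]

theorem braidOp_zero_update (q : ℝ) (f : (ℕ → Fin n) → V) (c : ℕ → Fin n) (i j : Fin n) :
    braidOp (q : ℂ) n V 0 f (Function.update (Function.update c 0 i) 1 j) =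
      ∑ k : Fin n, ∑ l : Fin n, Rhat q k l i j • f (Function.update (Function.update c 0 k) 1 l) := by
  have hs : Function.update (Function.update c 0 i) 1 j ∘ Equiv.swap 0 (0 + 1) =
      Function.update (Function.update c 0 j) 1 i := by
    funext m
    rcases m with _ | _ | m
    · simp
    · simp
    · simp [Equiv.swap_apply_of_ne_of_ne (show m + 1 + 1 ≠ 0 by omega)
        (show m + 1 + 1 ≠ 0 + 1 by omega)]
  have h0 : Function.update (Function.update c 0 i) 1 j 0 = i := by simp
  have h1 : Function.update (Function.update c 0 i) 1 j (0 + 1) = j := by simp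
  rw [braidOp_apply, hs, h0, h1]
  simp only [Rhat, add_smul, Finset.sum_add_distrib, ite_smul, zero_smul]
  congr 1
  · rw [Finset.sum_eq_single j (fun k _ hk => Finset.sum_eq_zero fun l _ => if_neg fun h =>
        hk (Fin.ext h.1)) (by simp),
      Finset.sum_eq_single i (fun l _ hl => if_neg fun h => hl (Fin.ext h.2)) (by simp)]
    by_cases h : i = j
    · simp [h]
    · simp [h, Ne.symm h, Fin.val_inj]
  · rw [Finset.sum_eq_single i (fun k _ hk => Finset.sum_eq_zero fun l _ => if_neg fun h =>
        hk (Fin.ext h.1)) (by simp),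
      Finset.sum_eq_single j (fun l _ hl => if_neg fun h => hl (Fin.ext h.2.1)) (by simp)]
    simp

theorem leftOp_update (x : Fin n → Fin n → V) (f : (ℕ → Fin n) → V) (c : ℕ → Fin n)
    (i j : Fin n) :
    leftOp x f (Function.update (Function.update c 0 i) 1 j) =
      ∑ k, x i k * f (Function.update (Function.update c 0 k) 1 j) := by
  have hs : ∀ k, Function.update (Function.update (Function.update c 0 i) 1 j) 0 k =
      Function.update (Function.update c 0 k) 1 j := fun k => by
    rw [Function.update_comm (by norm_num), Function.update_idem]
  simp [leftOp_apply, hs]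

/-- The reflection equation for the matrix `x`. -/
def ReflectionEq (q : ℝ) (x : Fin n → Fin n → V) : Prop :=
  ∀ a b c d : Fin n,
    ∑ i : Fin n, ∑ j : Fin n, ∑ k : Fin n, ∑ l : Fin n,
        (Rhat q k b j l * Rhat q i l c d) • (x i j * x k a) =
      ∑ i : Fin n, ∑ j : Fin n, ∑ k : Fin n, ∑ l : Fin n,
        (Rhat q j l i d * Rhat q a b k l) • (x c i * x j k)

theorem ReflectionEq.operator {q : ℝ} {x : Fin n → Fin n → V} (hx : ReflectionEq q x) :
    braidOp (q : ℂ) n V 0 * leftOp x * braidOp (q : ℂ) n V 0 * leftOp x =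
      leftOp x * braidOp (q : ℂ) n V 0 * leftOp x * braidOp (q : ℂ) n V 0 := by
  refine LinearMap.ext fun f => funext fun e => ?_
  have he : e = Function.update (Function.update e 0 (e 0)) 1 (e 1) := by simp
  rw [he]
  generalize e 0 = c
  generalize e 1 = d
  simp only [Module.End.mul_apply, braidOp_zero_update, leftOp_update]
  set F : Fin n → Fin n → V := fun a b => f (Function.update (Function.update e 0 a) 1 b) with hF
  have hsum := Finset.sum_congr (s₁ := (Finset.univ : Finset (Fin n))) rfl fun a _ =>
    Finset.sum_congr (s₁ := (Finset.univ : Finset (Fin n))) rfl fun b _ =>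
      congrArg (· * F a b) (hx a b c d)
  simp only [Finset.sum_mul] at hsum
  simp only [Finset.mul_sum, Finset.smul_sum]
  simp only [← Fintype.sum_prod_type'] at hsum ⊢
  refine Eq.trans ?_ (hsum.trans ?_)
  · refine Finset.sum_nbij' (fun t => (t.2.2.2.2.2, t.2.2.2.2.1, t.1, t.2.2.1, t.2.2.2.1, t.2.1))
      (fun t => (t.2.2.1, t.2.2.2.2.2, t.2.2.2.1, t.2.2.2.2.1, t.2.1, t.1))
      (by simp) (by simp) (by simp) (by simp) ?_
    rintro ⟨i, l, j, k, b, a⟩ -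
    simp only [hF, mul_smul_comm, smul_mul_assoc, smul_smul, mul_assoc]
    rw [mul_comm (Rhat q i l c d)]
  · refine Finset.sum_nbij' (fun t => (t.2.2.1, t.2.2.2.1, t.2.2.2.2.2, t.2.2.2.2.1, t.1, t.2.1))
      (fun t => (t.2.2.2.2.1, t.2.2.2.2.2, t.1, t.2.1, t.2.2.2.1, t.2.2.1))
      (by simp) (by simp) (by simp) (by simp) ?_
    rintro ⟨a, b, i, j, k, l⟩ -
    simp only [hF, mul_smul_comm, smul_mul_assoc, smul_smul, mul_assoc]

theorem affineBraidRels_braidOp {q : ℝ} (hq : q ≠ 0) {x : Fin n → Fin n → V}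
    (hx : ReflectionEq q x) : AffineBraidRels (braidOp (q : ℂ) n V) (leftOp x) where
  comm_X := commute_braidOp_leftOp _ x
  far _ _ := braidOp_commute _
  braid := braidOp_braid (by exact_mod_cast hq)
  reflection := hx.operator

/-- The factor contributed to `qEpsilon` by the entries `x, y` in two positions. -/
noncomputable def pairWeight (q : ℂ) (x y : Fin n) : ℂ :=
  if x < y then -q⁻¹ else if x = y then 0 else 1

/-- The pairs of positions `i < j` below `n`. -/
def positionPairs (n : ℕ) : Finset (ℕ × ℕ) :=
  (Finset.range n ×ˢ Finset.range n).filter fun t => t.1 < t.2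

/-- The `q`-antisymmetric tensor in the first `n` positions. -/
noncomputable def qEpsilon (q : ℂ) (c : ℕ → Fin n) : ℂ :=
  ∏ t ∈ positionPairs n, pairWeight q (c t.1) (c t.2)

theorem mem_positionPairs {t : ℕ × ℕ} : t ∈ positionPairs n ↔ t.1 < t.2 ∧ t.2 < n := by
  simp only [positionPairs, Finset.mem_filter, Finset.mem_product, Finset.mem_range]
  omega

theorem qEpsilon_eq_zero (q : ℂ) {c : ℕ → Fin n} {i j : ℕ} (hij : i < j) (hj : j < n)
    (h : c i = c j) : qEpsilon q c = 0 :=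
  Finset.prod_eq_zero (i := (i, j)) (mem_positionPairs.mpr ⟨hij, hj⟩) (by simp [pairWeight, h])

theorem qEpsilon_ne_zero {q : ℂ} (hq : q ≠ 0) {c : ℕ → Fin n}
    (h : Set.InjOn c (Set.Iio n)) : qEpsilon q c ≠ 0 := by
  refine Finset.prod_ne_zero_iff.mpr fun t ht => ?_
  obtain ⟨h1, h2⟩ := mem_positionPairs.mp ht
  have hne : c t.1 ≠ c t.2 := fun e => h1.ne (h (h1.trans h2) h2 e)
  simp only [pairWeight, hne, if_false]
  split_ifs <;> simp [hq]

theorem qEpsilon_eq_mul (q : ℂ) (c : ℕ → Fin n) {p : ℕ} (hp : p + 1 < n) :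
    qEpsilon q c = pairWeight q (c p) (c (p + 1)) *
      ∏ t ∈ (positionPairs n).erase (p, p + 1), pairWeight q (c t.1) (c t.2) :=
  (Finset.mul_prod_erase _ (fun t : ℕ × ℕ => pairWeight q (c t.1) (c t.2))
    (a := (p, p + 1)) (mem_positionPairs.mpr ⟨Nat.lt_succ_self p, hp⟩)).symm

theorem prod_erase_comp_swap (q : ℂ) (c : ℕ → Fin n) {p : ℕ} (hp : p + 1 < n) :
    ∏ t ∈ (positionPairs n).erase (p, p + 1),
        pairWeight q ((c ∘ Equiv.swap p (p + 1)) t.1) ((c ∘ Equiv.swap p (p + 1)) t.2) =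
      ∏ t ∈ (positionPairs n).erase (p, p + 1), pairWeight q (c t.1) (c t.2) := by
  have hmem : ∀ t ∈ (positionPairs n).erase (p, p + 1),
      (Equiv.swap p (p + 1) t.1, Equiv.swap p (p + 1) t.2) ∈
        (positionPairs n).erase (p, p + 1) := by
    rintro ⟨i, j⟩ ht
    simp only [Finset.mem_erase, mem_positionPairs, ne_eq, Prod.mk.injEq,
      Equiv.swap_apply_def] at ht ⊢
    split_ifs <;> omega
  exact Finset.prod_nbij' (fun t => (Equiv.swap p (p + 1) t.1, Equiv.swap p (p + 1) t.2))
    (fun t => (Equiv.swap p (p + 1) t.1, Equiv.swap p (p + 1) t.2)) hmem hmem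
    (by simp) (by simp) (by simp)

theorem braidOp_qEpsilon {q : ℂ} (hq : q ≠ 0) {p : ℕ} (hp : p + 1 < n) :
    braidOp q n V p (fun c => qEpsilon q c • (1 : V)) =
      (-q⁻¹) • fun c => qEpsilon q c • (1 : V) := by
  funext c
  rw [braidOp_apply, qEpsilon_eq_mul q c hp, qEpsilon_eq_mul q (c ∘ _) hp,
    prod_erase_comp_swap q c hp, Pi.smul_apply, qEpsilon_eq_mul q c hp]
  simp only [Function.comp_apply, Equiv.swap_apply_left, Equiv.swap_apply_right, pairWeight]
  rcases lt_trichotomy (c p) (c (p + 1)) with h | h | h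
  · simp only [h, h.ne, h.ne', h.not_gt, if_true, if_false]
    match_scalars
    field_simp
    ring
  · simp [h]
  · simp only [h, h.ne, h.ne', h.not_gt, if_true, if_false]
    module

theorem eq_zero_of_antisymmetric {q : ℂ} (hq0 : q ≠ 0) (hq : q + q⁻¹ ≠ 0) {f : (ℕ → Fin n) → V}
    (hf : ∀ p, p + 1 < n → braidOp q n V p f = (-q⁻¹) • f)
    (hdesc : ∀ c : ℕ → Fin n, (∀ p, p + 1 < n → c (p + 1) < c p) → f c = 0) : f = 0 := by
  funext c
  induction hm : ∑ i ∈ Finset.range n, i * (c i : ℕ) using Nat.strong_induction_on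
    generalizing c with
  | _ m ih =>
    by_cases h : ∀ p, p + 1 < n → c (p + 1) < c p
    · exact hdesc c h
    push Not at h
    obtain ⟨p, hp, hc⟩ := h
    have hfc := congrFun (hf p hp) c
    rw [braidOp_apply, Pi.smul_apply] at hfc
    obtain hlt | heq := hc.lt_or_eq
    · have hlt' : ∑ i ∈ Finset.range n, i * ((c ∘ Equiv.swap p (p + 1)) i : ℕ) < m := by
        have hmem : p ∈ Finset.range n := by simp; omega
        have hmem' : p + 1 ∈ (Finset.range n).erase p := by simp; omega
        rw [← hm, ← Finset.add_sum_erase _ _ hmem, ← Finset.add_sum_erase _ _ hmem',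
          ← Finset.add_sum_erase _ (fun i => i * (c i : ℕ)) hmem,
          ← Finset.add_sum_erase _ (fun i => i * (c i : ℕ)) hmem',
          Finset.sum_congr rfl (g := fun i => i * (c i : ℕ)) fun i hi => by
            simp only [Finset.mem_erase] at hi
            rw [Function.comp_apply, Equiv.swap_apply_of_ne_of_ne hi.2.1 hi.1]]
        have : (c p : ℕ) < c (p + 1) := hlt
        simp only [Function.comp_apply, Equiv.swap_apply_left, Equiv.swap_apply_right]
        nlinarith
      have h0 := ih _ hlt' (c ∘ Equiv.swap p (p + 1)) rfl
      rw [h0, Pi.zero_apply] at hfc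
      simp only [hlt, hlt.ne, if_true, if_false, smul_zero, zero_add] at hfc
      have : q • f c = 0 := by
        rw [show q • f c = (q - q⁻¹) • f c - (-q⁻¹) • f c by module, hfc, sub_self]
      exact (smul_eq_zero_iff_right hq0).mp this
    · have hcs : c ∘ Equiv.swap p (p + 1) = c := by
        ext i
        simp only [Function.comp_apply, Equiv.swap_apply_def]
        split_ifs <;> simp_all
      simp only [hcs, heq, lt_irrefl, if_true, if_false, zero_smul, add_zero] at hfc
      have : (q + q⁻¹) • f c = 0 := by rw [add_smul, hfc]; module
      exact (smul_eq_zero_iff_right hq).mp this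

theorem surjOn_of_injOn {c : ℕ → Fin n} (hc : Set.InjOn c (Set.Iio n)) (j : Fin n) :
    ∃ k < n, c k = j := by
  have hinj : Function.Injective fun k : Fin n => c k := fun k l h =>
    Fin.ext (hc k.2 l.2 h)
  obtain ⟨k, hk⟩ := Finite.surjective_of_injective hinj j
  exact ⟨k, k.2, hk⟩

theorem sum_mul_qEpsilon_update (q : ℂ) {c : ℕ → Fin n} (hc : Set.InjOn c (Set.Iio n))
    (y : Fin n → V) :
    ∑ j, y j * (qEpsilon q (Function.update c 0 j) • (1 : V)) = qEpsilon q c • y (c 0) := by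
  rw [Finset.sum_eq_single (c 0) _ (by simp)]
  · simp
  · intro j _ hj
    obtain ⟨k, hk, rfl⟩ := surjOn_of_injOn hc j
    have hk0 : k ≠ 0 := by rintro rfl; exact hj rfl
    rw [qEpsilon_eq_zero q (Nat.pos_of_ne_zero hk0) hk (by simp [hk0])]
    simp

theorem jucysMurphy_qEpsilon_apply {q : ℂ} (hq : q ≠ 0) (x : Fin n → Fin n → V) {i : ℕ}
    (hi : i < n) {c : ℕ → Fin n} (hc : Set.InjOn c (Set.Iio n)) (hlt : ∀ k < i, c i < c k) :
    jucysMurphy (braidOp q n V) (leftOp x) i (fun c => qEpsilon q c • (1 : V)) c =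
      (((-q⁻¹) ^ 2) ^ i * qEpsilon q c) • x (c i) (c i) := by
  induction i generalizing c with
  | zero =>
    simp only [jucysMurphy, leftOp_apply, sum_mul_qEpsilon_update q hc, pow_zero, one_mul]
  | succ i ih =>
    have hswap := Equiv.swap_apply_left i (i + 1)
    have hci : c (i + 1) < c i := hlt i (Nat.lt_succ_self i)
    have hε : qEpsilon q (c ∘ Equiv.swap i (i + 1)) = -q⁻¹ * qEpsilon q c := by
      rw [qEpsilon_eq_mul q _ hi, qEpsilon_eq_mul q c hi, prod_erase_comp_swap q c hi]
      simp [pairWeight, hci, hci.ne', hci.not_gt]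
    have hc' : Set.InjOn (c ∘ Equiv.swap i (i + 1)) (Set.Iio n) := by
      refine hc.comp (Equiv.injective _).injOn fun k hk => ?_
      simp only [Set.mem_Iio, Equiv.swap_apply_def] at hk ⊢
      split_ifs <;> omega
    have hlt' : ∀ k < i, (c ∘ Equiv.swap i (i + 1)) i < (c ∘ Equiv.swap i (i + 1)) k := by
      intro k hk
      rw [Function.comp_apply, Function.comp_apply, hswap,
        Equiv.swap_apply_of_ne_of_ne hk.ne (by omega)]
      exact hlt k (by omega)
    have key := ih (by omega) hc' hlt'
    simp only [jucysMurphy, Module.End.mul_apply, braidOp_qEpsilon hq hi, map_smul, Pi.smul_apply]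
    rw [braidOp_apply, if_neg hci.ne', if_neg hci.not_gt, key, hε]
    simp only [Function.comp_apply, hswap, zero_smul, add_zero, one_smul]
    match_scalars
    ring

/-- A strictly decreasing sequence of length `n` in `Fin n` lists all the elements. -/
theorem eq_rev_of_strictAnti {c : ℕ → Fin n} (hc : ∀ p, p + 1 < n → c (p + 1) < c p)
    (p : Fin n) : c p = p.rev := by
  have hle : ∀ p, p < n → (c p : ℕ) + p < n := by
    intro p
    induction p with
    | zero => intro _; simp
    | succ p ih =>
      intro hp
      have h1 := ih (by omega)
      have h2 : (c (p + 1) : ℕ) < c p := hc p hp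
      omega
  have hge : ∀ p ≤ n - 1, n ≤ (c p : ℕ) + p + 1 := by
    intro p hp
    induction hp using Nat.decreasingInduction with
    | self => omega
    | of_succ p hp ih =>
      have h2 : (c (p + 1) : ℕ) < c p := hc p (by omega)
      omega
  have h1 := hle p p.2
  have h2 := hge p (by omega)
  ext
  rw [Fin.val_rev]
  omega

/-- An idempotent solution of the reflection equation whose quantum trace is that of the
identity matrix is the identity matrix. -/
theorem ReflectionEq.eq_one_of_trace {q : ℝ} (hq : q ≠ 0) {x : Fin n → Fin n → V}
    (hx : ReflectionEq q x) (hidem : ∀ i k, ∑ j, x i j * x j k = x i k)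
    (htr : ∑ i : Fin n, (((-(q : ℂ)⁻¹) ^ 2) ^ (i : ℕ)) • x i.rev i.rev =
      (∑ i ∈ Finset.range n, ((-(q : ℂ)⁻¹) ^ 2) ^ i) • (1 : V)) (a m : Fin n) :
    x a m = if a = m then 1 else 0 := by
  have hn : 0 < n := a.pos
  have hqC : (q : ℂ) ≠ 0 := by exact_mod_cast hq
  have hqq : (q : ℂ) + (q : ℂ)⁻¹ ≠ 0 := by
    have : (q : ℂ) + (q : ℂ)⁻¹ = ((q ^ 2 + 1 : ℝ) : ℂ) / q := by
      push_cast
      field_simp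
    rw [this]
    exact div_ne_zero (by exact_mod_cast (by positivity : q ^ 2 + 1 ≠ 0)) hqC
  have h := affineBraidRels_braidOp hq hx
  set ω : (ℕ → Fin n) → V := fun c => qEpsilon (q : ℂ) c • (1 : V) with hω
  have hanti : ∀ p, p + 1 < n → braidOp (q : ℂ) n V p ω = (-(q : ℂ)⁻¹) • ω := fun p hp =>
    braidOp_qEpsilon hqC hp
  set κ : ℂ := ∑ i ∈ Finset.range n, ((-(q : ℂ)⁻¹) ^ 2) ^ i with hκ
  have hsum : (∑ i ∈ Finset.range n, jucysMurphy (braidOp (q : ℂ) n V) (leftOp x) i) ω =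
      κ • ω := by
    rw [← sub_eq_zero]
    refine eq_zero_of_antisymmetric hqC hqq (fun p hp => ?_) fun c hc => ?_
    · rw [map_sub, map_smul, hanti p hp, ← Module.End.mul_apply,
        (h.commute_sum_jucysMurphy (braidOp_mul_self hqC) hp).eq, Module.End.mul_apply,
        hanti p hp, map_smul]
      module
    · have hrev := eq_rev_of_strictAnti hc
      have hlt : ∀ i < n, ∀ k < i, c i < c k := fun i hi k hk => by
        rw [hrev ⟨i, hi⟩, hrev ⟨k, hk.trans hi⟩]
        exact Fin.rev_lt_rev.mpr hk
      have hinj : Set.InjOn c (Set.Iio n) := fun i hi k hk hik => by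
        by_contra hne
        obtain hlt' | hlt' := Nat.lt_or_gt_of_ne hne
        · exact (hlt k hk i hlt').ne hik.symm
        · exact (hlt i hi k hlt').ne hik
      rw [Pi.sub_apply, LinearMap.sum_apply, Finset.sum_apply, Finset.sum_congr rfl fun i hi =>
        jucysMurphy_qEpsilon_apply hqC x (Finset.mem_range.mp hi) hinj
          (hlt i (Finset.mem_range.mp hi)), Finset.sum_range]
      simp only [hrev, mul_comm _ (qEpsilon (q : ℂ) c), mul_smul]
      rw [← Finset.smul_sum, htr, Pi.smul_apply, hω, sub_eq_zero]
      exact smul_comm _ _ _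
  have hν : ∀ m < n, ∑ i ∈ Finset.Ico m n, ((-(q : ℂ)⁻¹) ^ 2) ^ i ≠ 0 := by
    intro m hm
    have hpos : 0 < ∑ i ∈ Finset.Ico m n, ((-q⁻¹) ^ 2) ^ i :=
      Finset.sum_pos (fun i _ => pow_pos (sq_pos_of_ne_zero (neg_ne_zero.mpr (inv_ne_zero hq))) _)
        (Finset.nonempty_Ico.mpr hm)
    exact_mod_cast hpos.ne'
  have hfix := h.X_apply_eq_self (leftOp_mul_self hidem) hn hanti hν hsum
  let c : ℕ → Fin n := fun k =>
    if hk : k < n then Equiv.swap ⟨0, hn⟩ m ⟨k, hk⟩ else m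
  have hinj : Set.InjOn c (Set.Iio n) := fun i hi k hk hik => by
    simp only [Set.mem_Iio] at hi hk
    simpa [c, hi, hk] using hik
  have hc0 : c 0 = m := by simp [c, hn]
  have hfa := congrFun hfix (Function.update c 0 a)
  simp only [leftOp_apply, hω, Function.update_self, Function.update_idem] at hfa
  rw [sum_mul_qEpsilon_update _ hinj, hc0] at hfa
  have hone := sum_mul_qEpsilon_update (q : ℂ) hinj fun j => if a = j then (1 : V) else 0
  simp only [ite_mul, one_mul, zero_mul, Finset.sum_ite_eq, Finset.mem_univ, if_true, hc0] at hone
  rw [hone] at hfa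
  exact (smul_right_injective V (qEpsilon_ne_zero hqC hinj)) hfa

end Tensor

section Restriction

theorem Rhat_add_left (q : ℝ) (t i j k l : ℕ) :
    Rhat q (t + i) (t + j) (t + k) (t + l) = Rhat q i j k l := by
  simp [Rhat]

theorem Rhat_eq_zero (q : ℝ) {i j k l : ℕ} (h : ¬(i = k ∧ j = l ∨ i = l ∧ j = k)) :
    Rhat q i j k l = 0 := by
  rw [Rhat, if_neg (by tauto), if_neg (by tauto), add_zero]

theorem sum_Icc_eq_sum_fin {M : Type*} [AddCommMonoid M] {N r : ℕ} {f : ℕ → M}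
    (hf : ∀ i ≤ r, f i = 0) :
    ∑ i ∈ Finset.Icc 1 N, f i = ∑ i : Fin (N - r), f (r + 1 + i) := by
  have hsub : Finset.Ico (r + 1) (N + 1) ⊆ Finset.Icc 1 N := fun i hi => by
    simp only [Finset.mem_Ico, Finset.mem_Icc] at hi ⊢
    omega
  rw [← Finset.sum_subset hsub fun i h1 h2 => hf i (by
      simp only [Finset.mem_Ico, Finset.mem_Icc] at h1 h2
      omega),
    Finset.sum_Ico_eq_sum_range, Nat.add_sub_add_right, Finset.sum_range]

theorem sum_Icc_four_eq {M : Type*} [AddCommMonoid M] {N r : ℕ} {f : ℕ → ℕ → ℕ → ℕ → M}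
    (hf : ∀ i j k l, i ≤ r ∨ j ≤ r ∨ k ≤ r ∨ l ≤ r → f i j k l = 0) :
    (∑ i ∈ Finset.Icc 1 N, ∑ j ∈ Finset.Icc 1 N, ∑ k ∈ Finset.Icc 1 N, ∑ l ∈ Finset.Icc 1 N,
        f i j k l) =
      ∑ i : Fin (N - r), ∑ j : Fin (N - r), ∑ k : Fin (N - r), ∑ l : Fin (N - r),
        f (r + 1 + i) (r + 1 + j) (r + 1 + k) (r + 1 + l) := by
  rw [sum_Icc_eq_sum_fin fun i hi => Finset.sum_eq_zero fun j _ => Finset.sum_eq_zero fun k _ =>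
    Finset.sum_eq_zero fun l _ => hf i j k l (by tauto)]
  refine Finset.sum_congr rfl fun i _ => ?_
  rw [sum_Icc_eq_sum_fin fun j hj => Finset.sum_eq_zero fun k _ =>
    Finset.sum_eq_zero fun l _ => hf _ j k l (by tauto)]
  refine Finset.sum_congr rfl fun j _ => ?_
  rw [sum_Icc_eq_sum_fin fun k hk => Finset.sum_eq_zero fun l _ => hf _ _ k l (by tauto)]
  exact Finset.sum_congr rfl fun k _ => sum_Icc_eq_sum_fin fun l hl => hf _ _ _ l (by tauto)

variable {q : ℝ} {N r : ℕ} {V : Type} [Ring V] [Algebra ℂ V]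

theorem GrassRels.congr {z w : ℕ → ℕ → V} (hz : GrassRels q N r z)
    (hzw : ∀ i ∈ Finset.Icc 1 N, ∀ j ∈ Finset.Icc 1 N, z i j = w i j) : GrassRels q N r w := by
  obtain ⟨h1, h2, h3⟩ := hz
  refine ⟨fun a ha b hb c hc d hd => ?_, ?_, fun i hi k hk => ?_⟩
  · refine Eq.trans ?_ ((h1 a ha b hb c hc d hd).trans ?_) <;>
      refine Finset.sum_congr rfl fun i hi => Finset.sum_congr rfl fun j hj =>
        Finset.sum_congr rfl fun k hk => Finset.sum_congr rfl fun l hl => ?_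
    · rw [hzw i hi j hj, hzw k hk a ha]
    · rw [hzw c hc i hi, hzw j hj k hk]
  · rw [← h2]
    exact Finset.sum_congr rfl fun i hi => (hzw i hi i hi).symm
  · rw [← hzw i hi k hk, ← h3 i hi k hk]
    exact congrArg _ (Finset.sum_congr rfl fun n hn => by rw [hzw i hi n hn, hzw n hn k hk])

theorem GrassRels.map {W : Type} [Ring W] [Algebra ℂ W] (φ : V →ₐ[ℂ] W) {z : ℕ → ℕ → V}
    (hz : GrassRels q N r z) : GrassRels q N r fun i j => φ (z i j) := by
  obtain ⟨h1, h2, h3⟩ := hz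
  refine ⟨fun a ha b hb c hc d hd => ?_, ?_, fun i hi k hk => ?_⟩
  · simpa only [map_sum, map_smul, map_mul] using congrArg φ (h1 a ha b hb c hc d hd)
  · simpa only [map_sum, AlgHom.commutes] using congrArg φ h2
  · simpa only [map_sum, map_smul, map_mul] using congrArg φ (h3 i hi k hk)

/-- The lower right block of `z`, rescaled to become idempotent. -/
noncomputable def scaledBlock (q : ℝ) (N r : ℕ) (z : ℕ → ℕ → V) (i j : Fin (N - r)) : V :=
  (q : ℂ) ^ (2 * (N : ℤ) + 1 - 2 * ((r + 1 + j : ℕ) : ℤ)) • z (r + 1 + i) (r + 1 + j)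

theorem add_mem_Icc (i : Fin (N - r)) : r + 1 + (i : ℕ) ∈ Finset.Icc 1 N := by
  rw [Finset.mem_Icc]
  omega

theorem GrassRels.scaledBlock_reflectionEq (hq : q ≠ 0) {z : ℕ → ℕ → V}
    (hz : GrassRels q N r z) (h0 : ∀ i j, i ≤ r ∨ j ≤ r → z i j = 0) :
    ReflectionEq q (scaledBlock q N r z) := by
  have hqC : (q : ℂ) ≠ 0 := by exact_mod_cast hq
  intro a b c d
  have h := hz.1 _ (add_mem_Icc a) _ (add_mem_Icc b) _ (add_mem_Icc c) _ (add_mem_Icc d)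
  rw [sum_Icc_four_eq (r := r), sum_Icc_four_eq (r := r)] at h
  · have h' := congrArg (((q : ℂ) ^ (2 * (2 * (N : ℤ) + 1) - 2 * ((r + 1 + a : ℕ) : ℤ) -
      2 * ((r + 1 + b : ℕ) : ℤ))) • ·) h
    simp only [Finset.smul_sum, Rhat_add_left] at h'
    refine Eq.trans ?_ (h'.trans ?_)
    · refine Finset.sum_congr rfl fun i _ => Finset.sum_congr rfl fun j _ =>
        Finset.sum_congr rfl fun k _ => Finset.sum_congr rfl fun l _ => ?_
      simp only [scaledBlock, smul_mul_assoc, mul_smul_comm, smul_smul]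
      congr 1
      have hpow : (q : ℂ) ^ (2 * (N : ℤ) + 1 - 2 * ((r + 1 + a : ℕ) : ℤ)) *
          (q : ℂ) ^ (2 * (N : ℤ) + 1 - 2 * ((r + 1 + j : ℕ) : ℤ)) =
          (q : ℂ) ^ (2 * (2 * (N : ℤ) + 1) - 2 * ((r + 1 + a : ℕ) : ℤ) -
            2 * ((r + 1 + b : ℕ) : ℤ)) *
          (q : ℂ) ^ (2 * ((r + 1 + b : ℕ) : ℤ) - 2 * ((r + 1 + j : ℕ) : ℤ)) := by
        simp only [← zpow_add₀ hqC]
        congr 1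
        ring
      linear_combination (Rhat q k b j l * Rhat q i l c d) * hpow
    · refine Finset.sum_congr rfl fun i _ => Finset.sum_congr rfl fun j _ =>
        Finset.sum_congr rfl fun k _ => Finset.sum_congr rfl fun l _ => ?_
      simp only [scaledBlock, smul_mul_assoc, mul_smul_comm, smul_smul]
      congr 1
      by_cases hkl : ((a : ℕ) = k ∧ (b : ℕ) = l ∨ (a : ℕ) = l ∧ (b : ℕ) = k)
      · have hpow : (q : ℂ) ^ (2 * (N : ℤ) + 1 - 2 * ((r + 1 + k : ℕ) : ℤ)) *
            (q : ℂ) ^ (2 * (N : ℤ) + 1 - 2 * ((r + 1 + i : ℕ) : ℤ)) =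
            (q : ℂ) ^ (2 * (2 * (N : ℤ) + 1) - 2 * ((r + 1 + a : ℕ) : ℤ) -
              2 * ((r + 1 + b : ℕ) : ℤ)) *
            (q : ℂ) ^ (2 * ((r + 1 + l : ℕ) : ℤ) - 2 * ((r + 1 + i : ℕ) : ℤ)) := by
          simp only [← zpow_add₀ hqC]
          congr 1
          omega
        linear_combination -(Rhat q j l i d * Rhat q a b k l) * hpow
      · simp [Rhat_eq_zero q hkl]
  · rintro i j k l h
    by_cases hl : l ≤ r
    · rw [Rhat_eq_zero q (i := r + 1 + a) (by omega)]
      simp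
    · obtain h | h : (j ≤ r ∨ k ≤ r) ∨ i ≤ r := by tauto
      · simp [h0 j k h]
      · simp [h0 _ i (Or.inr h)]
  · rintro i j k l h
    by_cases hl : l ≤ r
    · rw [Rhat_eq_zero q (i := i) (by omega)]
      simp
    · obtain h | h : (i ≤ r ∨ j ≤ r) ∨ k ≤ r := by tauto
      · simp [h0 i j h]
      · simp [h0 k _ (Or.inl h)]

theorem GrassRels.scaledBlock_idempotent (hq : q ≠ 0) {z : ℕ → ℕ → V}
    (hz : GrassRels q N r z) (h0 : ∀ i j, i ≤ r ∨ j ≤ r → z i j = 0) (i k : Fin (N - r)) :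
    ∑ j, scaledBlock q N r z i j * scaledBlock q N r z j k = scaledBlock q N r z i k := by
  have hqC : (q : ℂ) ≠ 0 := by exact_mod_cast hq
  have h := hz.2.2 _ (add_mem_Icc i) _ (add_mem_Icc k)
  rw [sum_Icc_eq_sum_fin fun n hn => by simp [h0 n _ (Or.inl hn)], Finset.smul_sum] at h
  conv_rhs => rw [scaledBlock, ← h, Finset.smul_sum]
  refine Finset.sum_congr rfl fun j _ => ?_
  simp only [scaledBlock, smul_mul_assoc, mul_smul_comm, smul_smul]
  congr 1
  simp only [← zpow_add₀ hqC]
  congr 1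

theorem GrassRels.scaledBlock_trace (hq : q ≠ 0) (hq1 : q ≠ 1) (hq2 : q ≠ -1) (hr : r ≤ N)
    {z : ℕ → ℕ → V} (hz : GrassRels q N r z) (h0 : ∀ i j, i ≤ r ∨ j ≤ r → z i j = 0) :
    ∑ i : Fin (N - r), (((-(q : ℂ)⁻¹) ^ 2) ^ (i : ℕ)) • scaledBlock q N r z i.rev i.rev =
      (∑ i ∈ Finset.range (N - r), ((-(q : ℂ)⁻¹) ^ 2) ^ i) • (1 : V) := by
  have hqC : (q : ℂ) ≠ 0 := by exact_mod_cast hq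
  have hsq : (q : ℂ) ^ 2 ≠ 1 := by
    have : q ^ 2 ≠ 1 := by simp [sq_eq_one_iff, hq1, hq2]
    exact_mod_cast this
  have h := hz.2.1
  rw [sum_Icc_eq_sum_fin fun i hi => h0 i i (Or.inl hi)] at h
  have hterm : ∀ i : Fin (N - r), (((-(q : ℂ)⁻¹) ^ 2) ^ (i : ℕ)) •
      scaledBlock q N r z i.rev i.rev = (q : ℂ) • z (r + 1 + i.rev) (r + 1 + i.rev) := by
    intro i
    have hi := i.2
    rw [scaledBlock, smul_smul]
    congr 1
    rw [neg_sq, ← pow_mul, inv_pow, ← zpow_natCast, ← zpow_neg, ← zpow_add₀ hqC]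
    conv_rhs => rw [← zpow_one (q : ℂ)]
    congr 1
    rw [Fin.val_rev]
    omega
  have hrev : ∑ i : Fin (N - r), z (r + 1 + i.rev) (r + 1 + i.rev) =
      ∑ i : Fin (N - r), z (r + 1 + i) (r + 1 + i) :=
    Equiv.sum_comp Fin.revPerm fun i : Fin (N - r) => z (r + 1 + i) (r + 1 + i)
  rw [Finset.sum_congr rfl fun i _ => hterm i, ← Finset.smul_sum, hrev, h,
    Algebra.algebraMap_eq_smul_one, smul_smul]
  congr 1
  have hne : (-(q : ℂ)⁻¹) ^ 2 ≠ 1 := by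
    rw [neg_sq, inv_pow]
    simpa using hsq
  have hpow : (q : ℂ) ^ (-(2 : ℤ) * ((N : ℤ) - (r : ℤ))) = ((-(q : ℂ)⁻¹) ^ 2) ^ (N - r) := by
    rw [neg_sq, ← pow_mul, inv_pow, ← zpow_natCast, ← zpow_neg]
    congr 1
    push_cast [Nat.cast_sub hr]
    ring
  rw [geom_sum_eq hne, hpow]
  generalize ((-(q : ℂ)⁻¹) ^ 2) ^ (N - r) = y
  have hd : (q : ℂ) - (q : ℂ)⁻¹ ≠ 0 := by
    intro hd
    apply hsq
    field_simp at hd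
    linear_combination hd
  rw [mul_div_assoc', div_eq_div_iff hd (sub_ne_zero.mpr hne)]
  field_simp
  ring

/-- If the first `r` rows and columns vanish, the relations determine the remaining block. -/
theorem GrassRels.eq_diagonal (hq : q ≠ 0) (hq1 : q ≠ 1) (hq2 : q ≠ -1) (hr : r ≤ N)
    {z : ℕ → ℕ → V} (hz : GrassRels q N r z) (h0 : ∀ i j, i ≤ r ∨ j ≤ r → z i j = 0)
    {i j : ℕ} (hi : i ≤ N) (hj : j ≤ N) :
    z i j = algebraMap ℂ V
      (if i = j ∧ r < i then (q : ℂ) ^ (2 * (i : ℤ) - (2 * (N : ℤ) + 1)) else 0) := by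
  have hqC : (q : ℂ) ≠ 0 := by exact_mod_cast hq
  by_cases hij : i ≤ r ∨ j ≤ r
  · rw [h0 i j hij, if_neg (by omega), map_zero]
  push Not at hij
  obtain ⟨i, rfl⟩ := Nat.exists_eq_add_of_lt hij.1
  obtain ⟨j, rfl⟩ := Nat.exists_eq_add_of_lt hij.2
  rw [add_right_comm r i 1, add_right_comm r j 1]
  have h := (hz.scaledBlock_reflectionEq hq h0).eq_one_of_trace hq
    (hz.scaledBlock_idempotent hq h0) (hz.scaledBlock_trace hq hq1 hq2 hr h0)
    ⟨i, by omega⟩ ⟨j, by omega⟩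
  have h' := congrArg
    (((q : ℂ) ^ (2 * ((r + 1 + j : ℕ) : ℤ) - (2 * (N : ℤ) + 1))) • ·) h
  simp only [scaledBlock, smul_smul, ← zpow_add₀ hqC, Fin.mk.injEq] at h'
  rw [show ∀ a b : ℤ, a - b + (b - a) = 0 by intros; ring, zpow_zero, one_smul] at h'
  rw [h', Algebra.algebraMap_eq_smul_one]
  by_cases hij' : i = j
  · subst hij'
    simp [show r < r + 1 + i by omega]
  · simp [hij']

end Restriction

/-- Lemma `I=B+`.  The two-sided ideal of `B = O_q(Gr(r,N))`
generated by `{z_{kl} | k ≤ r or l ≤ r}` equals the augmentation ideal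
`B⁺ = B ∩ ker ε`.  (The two-sided ideal is realized as the linear span of the
elements `a · z_{kl} · b`.) -/
theorem ideal_generated_by_small_z_eq_Bplus
    (q : ℝ) (hq₁ : q ≠ -1) (hq₂ : q ≠ 0) (hq₃ : q ≠ 1)
    (N r : ℕ) (hN : 2 ≤ N) (hr1 : 1 ≤ r) (hr2 : r ≤ N - 1)
    (G : QGrassData q N r) :
    Submodule.span ℂ
        {x : G.B | ∃ a b : G.B, ∃ k ∈ Finset.Icc 1 N, ∃ l ∈ Finset.Icc 1 N,
          (k ≤ r ∨ l ≤ r) ∧ x = a * G.z k l * b} =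
      LinearMap.ker G.counit.toLinearMap := by
  have hr : r ≤ N := by omega
  set S : Submodule ℂ G.B := Submodule.span ℂ
    {x : G.B | ∃ a b : G.B, ∃ k ∈ Finset.Icc 1 N, ∃ l ∈ Finset.Icc 1 N,
      (k ≤ r ∨ l ≤ r) ∧ x = a * G.z k l * b} with hS
  have hleft : ∀ {x y : G.B}, y ∈ S → x * y ∈ S := by
    intro x y hy
    refine Submodule.span_induction (p := fun y _ => x * y ∈ S) ?_ (by simp)
      (fun u v _ _ hu hv => by simpa only [mul_add] using S.add_mem hu hv)
      (fun c u _ hu => by simpa only [mul_smul_comm] using S.smul_mem c hu) hy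
    rintro _ ⟨a, b, k, hk, l, hl, hkl, rfl⟩
    exact Submodule.subset_span ⟨x * a, b, k, hk, l, hl, hkl, by simp only [mul_assoc]⟩
  have hright : ∀ {x y : G.B}, x ∈ S → x * y ∈ S := by
    intro x y hx
    refine Submodule.span_induction (p := fun x _ => x * y ∈ S) ?_ (by simp)
      (fun u v _ _ hu hv => by simpa only [add_mul] using S.add_mem hu hv)
      (fun c u _ hu => by simpa only [smul_mul_assoc] using S.smul_mem c hu) hx
    rintro _ ⟨a, b, k, hk, l, hl, hkl, rfl⟩
    exact Submodule.subset_span ⟨a, b * y, k, hk, l, hl, hkl, by simp only [mul_assoc]⟩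
  apply le_antisymm
  · refine Submodule.span_le.mpr ?_
    rintro _ ⟨a, b, k, hk, l, hl, hkl, rfl⟩
    have hzero : G.counit (G.z k l) = 0 := by
      rw [G.counit_z k hk l hl, if_neg (by omega)]
    simp [hzero]
  · let I : TwoSidedIdeal G.B := TwoSidedIdeal.mk' (S : Set G.B) S.zero_mem S.add_mem S.neg_mem
      hleft hright
    let φ : G.B →ₐ[ℂ] I.ringCon.Quotient := RingCon.mkₐ ℂ I.ringCon
    have hφ : ∀ x, φ x = 0 ↔ x ∈ S := fun x => by
      change ((x : I.ringCon.Quotient) = ((0 : G.B) : I.ringCon.Quotient)) ↔ _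
      rw [RingCon.eq, ← TwoSidedIdeal.mem_iff]
      exact TwoSidedIdeal.mem_mk' _ _ _ _ _ _ x
    let w : ℕ → ℕ → I.ringCon.Quotient := fun i j =>
      if i ∈ Finset.Icc 1 N ∧ j ∈ Finset.Icc 1 N then φ (G.z i j) else 0
    have hw : ∀ i ∈ Finset.Icc 1 N, ∀ j ∈ Finset.Icc 1 N, φ (G.z i j) = w i j :=
      fun i hi j hj => (if_pos ⟨hi, hj⟩).symm
    have hw0 : ∀ i j, i ≤ r ∨ j ≤ r → w i j = 0 := fun i j hij => by
      by_cases h : i ∈ Finset.Icc 1 N ∧ j ∈ Finset.Icc 1 N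
      · rw [← hw i h.1 j h.2, hφ]
        exact Submodule.subset_span ⟨1, 1, i, h.1, j, h.2, hij, by simp⟩
      · exact if_neg h
    have hext : φ = (Algebra.ofId ℂ _).comp G.counit := by
      refine AlgHom.ext_of_adjoin_eq_top G.gen ?_
      rintro _ ⟨i, hi, j, hj, rfl⟩
      rw [hw i hi j hj, ((G.rels.map φ).congr hw).eq_diagonal hq₂ hq₃ hq₁ hr hw0
        (Finset.mem_Icc.mp hi).2 (Finset.mem_Icc.mp hj).2, ← G.counit_z i hi j hj]
      rfl
    intro x hx
    have hx' : G.counit x = 0 := hx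
    rw [← hφ, hext, AlgHom.comp_apply, hx', map_zero]
end
end

section
/- Let k ∈ ℕ and let f ∈ B° be a functional that vanishes on every monomial of the form x = x_{−,1}⋯x_{−,k₋} · x⁺_{0,1}⋯x⁺_{0,k₀} · x_{+,1}⋯x_{+,k₊} with k₋ + k₀ + k₊ ≥ k, where the x_{−,l} are generators z_ij (i > j), the x⁺_{0,l} are elements z_ii − ε(z_ii), and the x_{+,l} are generators z_ij (i < j). Then f vanishes on (B⁺)^{2k}. -/
noncomputable section

open scoped TensorProduct

/-- `f` belongs to the dual coalgebra `B°` of `B`, i.e. the product functional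
`(a,b) ↦ f(ab)` admits a finite decomposition `f(ab) = Σᵢ gᵢ(a) hᵢ(b)`. -/
def IsDualCoalgebraElem {q : ℝ} {N r : ℕ} (G : QGrassData q N r)
    (f : G.B →ₗ[ℂ] ℂ) : Prop :=
  ∃ (n : ℕ) (g h : Fin n → (G.B →ₗ[ℂ] ℂ)),
    ∀ a b : G.B, f (a * b) = ∑ i, g i a * h i b

section ReflectionEquation

variable {A : Type} [Ring A] [Algebra ℂ A]

theorem sum_sum_sum_reverse (s : Finset ℕ) (g : ℕ → ℕ → ℕ → A) :
    ∑ a ∈ s, ∑ b ∈ s, ∑ c ∈ s, g a b c = ∑ c ∈ s, ∑ b ∈ s, ∑ a ∈ s, g a b c := by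
  rw [Finset.sum_comm, Finset.sum_congr rfl fun b _ => Finset.sum_comm, Finset.sum_comm]

theorem sum_Rhat_smul_left (q : ℝ) {N c d : ℕ} (hc : c ∈ Finset.Icc 1 N)
    (hd : d ∈ Finset.Icc 1 N) (F : ℕ → ℕ → A) :
    ∑ i ∈ Finset.Icc 1 N, ∑ l ∈ Finset.Icc 1 N, Rhat q i l c d • F i l =
      (if c = d then (q : ℂ) else 1) • F d c +
        (if c < d then (q : ℂ) - (q : ℂ)⁻¹ else 0) • F c d := by
  simp only [Rhat, add_smul, Finset.sum_add_distrib, ite_and, ite_smul, zero_smul]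
  congr 1
  · rw [Finset.sum_eq_single d (fun x _ hx => by simp [hx]) (by simp_all),
      Finset.sum_eq_single c (fun x _ hx => by simp [hx]) (by simp_all)]
    by_cases h : c = d <;> simp [h, eq_comm]
  · rw [Finset.sum_eq_single c (fun x _ hx => by simp [hx]) (by simp_all),
      Finset.sum_eq_single d (fun x _ hx => by simp [hx]) (by simp_all)]
    simp

theorem sum_Rhat_smul_right (q : ℝ) {N a b : ℕ} (ha : a ∈ Finset.Icc 1 N)
    (hb : b ∈ Finset.Icc 1 N) (F : ℕ → ℕ → A) :
    ∑ k ∈ Finset.Icc 1 N, ∑ l ∈ Finset.Icc 1 N, Rhat q a b k l • F k l =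
      (if a = b then (q : ℂ) else 1) • F b a +
        (if a < b then (q : ℂ) - (q : ℂ)⁻¹ else 0) • F a b := by
  simp only [Rhat, add_smul, Finset.sum_add_distrib, ite_and, ite_smul, zero_smul]
  congr 1
  · rw [Finset.sum_eq_single b (fun x _ hx => by simp [Ne.symm hx]) (by simp_all),
      Finset.sum_eq_single a (fun x _ hx => by simp [Ne.symm hx]) (by simp_all)]
    by_cases h : a = b <;> simp [h]
  · rw [Finset.sum_eq_single a (fun x _ hx => by simp [Ne.symm hx]) (by simp_all),
      Finset.sum_eq_single b (fun x _ hx => by simp [Ne.symm hx]) (by simp_all)]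
    simp

theorem sum_Rhat_smul_cross (q : ℝ) {N b l : ℕ} (hb : b ∈ Finset.Icc 1 N)
    (hl : l ∈ Finset.Icc 1 N) (F : ℕ → ℕ → A) :
    ∑ k ∈ Finset.Icc 1 N, ∑ j ∈ Finset.Icc 1 N,
        ((q : ℂ) ^ (2 * (b : ℤ) - 2 * (j : ℤ)) * Rhat q k b j l) • F j k =
      (if b = l then (q : ℂ) else 1) • F b l +
        (if b = l then (q : ℂ) - (q : ℂ)⁻¹ else 0) •
          ∑ j ∈ Finset.Ico 1 b, ((q : ℂ) ^ (2 * (b : ℤ) - 2 * (j : ℤ))) • F j j := by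
  simp only [Rhat, mul_add, add_smul, Finset.sum_add_distrib, ite_and, mul_ite, mul_zero,
    ite_smul, zero_smul]
  congr 1
  · rw [Finset.sum_eq_single l (fun x _ hx => by simp [hx]) (by simp_all),
      Finset.sum_eq_single b (fun x _ hx => by simp [Ne.symm hx]) (by simp_all)]
    by_cases h : b = l <;> simp [h, eq_comm]
  · by_cases h : b = l
    · subst h
      have hs : Finset.Ico 1 b ⊆ Finset.Icc 1 N := fun i hi => by
        simp only [Finset.mem_Icc, Finset.mem_Ico] at *; omega
      rw [← Finset.sum_subset hs]
      · simp only [if_true, Finset.smul_sum]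
        refine Finset.sum_congr rfl fun k hk => ?_
        rw [Finset.sum_eq_single k (fun x _ hx => by simp [Ne.symm hx]) (fun h => absurd (hs hk) h)]
        simp [(Finset.mem_Ico.1 hk).2, smul_smul, mul_comm]
      · intro k hk hk'
        have : ¬ k < b := by simp only [Finset.mem_Icc, Finset.mem_Ico] at *; omega
        simp [this]
    · simp [h]

/-- The sum `Σ_{i ∈ s} Q^{2(d-i)} x_{ci} x_{ib}`. -/
def weightedSum (Q : ℂ) (x : ℕ → ℕ → A) (s : Finset ℕ) (d c b : ℕ) : A :=
  ∑ i ∈ s, (Q ^ (2 * (d : ℤ) - 2 * (i : ℤ))) • (x c i * x i b)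

theorem reflection_equation_explicit {q : ℝ} {N r : ℕ} {z : ℕ → ℕ → A} (h : GrassRels q N r z)
    {a b c d : ℕ} (ha : a ∈ Finset.Icc 1 N) (hb : b ∈ Finset.Icc 1 N)
    (hc : c ∈ Finset.Icc 1 N) (hd : d ∈ Finset.Icc 1 N) :
    (if c = d then (q : ℂ) else 1) •
        ((if b = c then (q : ℂ) else 1) • (z d b * z c a) +
          (if b = c then (q : ℂ) - (q : ℂ)⁻¹ else 0) •
            weightedSum (q : ℂ) z (Finset.Ico 1 b) b d a) +
      (if c < d then (q : ℂ) - (q : ℂ)⁻¹ else 0) •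
        ((if b = d then (q : ℂ) else 1) • (z c b * z d a) +
          (if b = d then (q : ℂ) - (q : ℂ)⁻¹ else 0) •
            weightedSum (q : ℂ) z (Finset.Ico 1 b) b c a) =
    (if a = b then (q : ℂ) else 1) •
        ((if a = d then (q : ℂ) else 1) • (z c a * z d b) +
          (if a = d then (q : ℂ) - (q : ℂ)⁻¹ else 0) •
            weightedSum (q : ℂ) z (Finset.Ico 1 a) a c b) +
      (if a < b then (q : ℂ) - (q : ℂ)⁻¹ else 0) •
        ((if b = d then (q : ℂ) else 1) • (z c b * z d a) +
          (if b = d then (q : ℂ) - (q : ℂ)⁻¹ else 0) •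
            weightedSum (q : ℂ) z (Finset.Ico 1 b) b c a) := by
  have key := h.1 a ha b hb c hc d hd
  have hL : ∀ i ∈ Finset.Icc 1 N, ∀ l ∈ Finset.Icc 1 N,
      ∑ k ∈ Finset.Icc 1 N, ∑ j ∈ Finset.Icc 1 N,
        ((q : ℂ) ^ (2 * (b : ℤ) - 2 * (j : ℤ)) * Rhat q k b j l * Rhat q i l c d) •
          (z i j * z k a) =
      Rhat q i l c d • ((if b = l then (q : ℂ) else 1) • (z i b * z l a) +
        (if b = l then (q : ℂ) - (q : ℂ)⁻¹ else 0) •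
          weightedSum (q : ℂ) z (Finset.Ico 1 b) b i a) := by
    intro i _ l hl
    rw [weightedSum, ← sum_Rhat_smul_cross q hb hl (fun j k => z i j * z k a)]
    simp only [Finset.smul_sum, smul_smul]
    refine Finset.sum_congr rfl fun k _ => Finset.sum_congr rfl fun j _ => ?_
    rw [mul_comm (Rhat q i l c d)]
  have hR : ∀ k ∈ Finset.Icc 1 N, ∀ l ∈ Finset.Icc 1 N,
      ∑ j ∈ Finset.Icc 1 N, ∑ i ∈ Finset.Icc 1 N,
        ((q : ℂ) ^ (2 * (l : ℤ) - 2 * (i : ℤ)) * Rhat q j l i d * Rhat q a b k l) •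
          (z c i * z j k) =
      Rhat q a b k l • ((if l = d then (q : ℂ) else 1) • (z c l * z d k) +
        (if l = d then (q : ℂ) - (q : ℂ)⁻¹ else 0) •
          weightedSum (q : ℂ) z (Finset.Ico 1 l) l c k) := by
    intro k _ l hl
    rw [weightedSum, ← sum_Rhat_smul_cross q hl hd (fun i j => z c i * z j k)]
    simp only [Finset.smul_sum, smul_smul]
    refine Finset.sum_congr rfl fun k _ => Finset.sum_congr rfl fun j _ => ?_
    rw [mul_comm (Rhat q a b _ l)]
  rw [← sum_Rhat_smul_left q hc hd (fun i l =>
      (if b = l then (q : ℂ) else 1) • (z i b * z l a) +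
        (if b = l then (q : ℂ) - (q : ℂ)⁻¹ else 0) •
          weightedSum (q : ℂ) z (Finset.Ico 1 b) b i a),
    ← sum_Rhat_smul_right q ha hb (fun k l =>
      (if l = d then (q : ℂ) else 1) • (z c l * z d k) +
        (if l = d then (q : ℂ) - (q : ℂ)⁻¹ else 0) •
          weightedSum (q : ℂ) z (Finset.Ico 1 l) l c k)]
  rw [← Finset.sum_congr rfl fun i hi => Finset.sum_congr rfl fun l hl => hL i hi l hl,
    ← Finset.sum_congr rfl fun i hi => Finset.sum_congr rfl fun l hl => hR i hi l hl]
  refine Eq.trans ?_ (key.trans ?_)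
  · exact Finset.sum_congr rfl fun i _ => sum_sum_sum_reverse _ _
  · symm
    rw [Finset.sum_congr rfl fun k _ => sum_sum_sum_reverse _ _, sum_sum_sum_reverse,
      Finset.sum_comm]

/-- The value of the counit on the diagonal generator `z_{ii}`. -/
def counitDiag (q : ℝ) (N r i : ℕ) : ℂ :=
  if r < i then (q : ℂ) ^ (2 * (i : ℤ) - (2 * (N : ℤ) + 1)) else 0

/-- The elements `z_{ij} - ε(z_{ij})`. -/
def shifted (q : ℝ) (N r : ℕ) (z : ℕ → ℕ → A) (i j : ℕ) : A :=
  if i = j then z i i - algebraMap ℂ A (counitDiag q N r i) else z i j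

/-- The part `Σ_{i<d}` of the weighted sum if `d ≤ r`, and minus its complement `Σ_{i≥d}`
if `r < d`. -/
def truncatedSum (Q : ℂ) (N r : ℕ) (x : ℕ → ℕ → A) (d c b : ℕ) : A :=
  if r < d then -weightedSum Q x (Finset.Icc d N) d c b
  else weightedSum Q x (Finset.Ico 1 d) d c b

theorem eq_shifted_of_ne (q : ℝ) (N r : ℕ) (z : ℕ → ℕ → A) {i j : ℕ} (h : i ≠ j) :
    z i j = shifted q N r z i j := by
  simp [shifted, h]

theorem eq_shifted_add (q : ℝ) (N r : ℕ) (z : ℕ → ℕ → A) (i j : ℕ) :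
    z i j = shifted q N r z i j + (if i = j then counitDiag q N r i else 0) • (1 : A) := by
  by_cases h : i = j
  · subst h; simp [shifted, Algebra.algebraMap_eq_smul_one]
  · simp [shifted, h]

theorem zpow_mul_counitDiag {q : ℝ} (hq : q ≠ 0) {N r i d : ℕ} (hd : r < d) (hi : r < i) :
    (q : ℂ) ^ (2 * (d : ℤ) - 2 * (i : ℤ)) * counitDiag q N r i = counitDiag q N r d := by
  have hq' : (q : ℂ) ≠ 0 := by exact_mod_cast hq
  rw [counitDiag, counitDiag, if_pos hi, if_pos hd, ← zpow_add₀ hq']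
  congr 1; ring

theorem weightedSum_full {q : ℝ} (hq : q ≠ 0) {N r : ℕ} {z : ℕ → ℕ → A}
    (h : GrassRels q N r z) {b c d : ℕ} (hb : b ∈ Finset.Icc 1 N) (hc : c ∈ Finset.Icc 1 N)
    (hd : r < d) :
    weightedSum (q : ℂ) z (Finset.Icc 1 N) d c b = counitDiag q N r d • z c b := by
  have hq' : (q : ℂ) ≠ 0 := by exact_mod_cast hq
  rw [← h.2.2 c hc b hb, weightedSum, Finset.smul_sum, Finset.smul_sum]
  refine Finset.sum_congr rfl fun i _ => ?_
  rw [smul_smul, smul_smul, counitDiag, if_pos hd, ← zpow_add₀ hq', ← zpow_add₀ hq']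
  congr 2; ring

theorem weightedSum_upper {q : ℝ} (hq : q ≠ 0) {N r : ℕ} (z : ℕ → ℕ → A)
    {b c d : ℕ} (hb : b ∈ Finset.Icc 1 N) (hc : c ∈ Finset.Icc 1 N) (hd : r < d) :
    weightedSum (q : ℂ) z (Finset.Icc d N) d c b =
      weightedSum (q : ℂ) (shifted q N r z) (Finset.Icc d N) d c b +
      (counitDiag q N r d * ((if d ≤ c then 1 else 0) + (if d ≤ b then 1 else 0))) •
          shifted q N r z c b +
      (if c = b ∧ d ≤ b then counitDiag q N r d * counitDiag q N r b else 0) • (1 : A) := by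
  have h1 : ∀ i ∈ Finset.Icc d N,
      ((q : ℂ) ^ (2 * (d : ℤ) - 2 * (i : ℤ))) • (z c i * z i b) =
      ((q : ℂ) ^ (2 * (d : ℤ) - 2 * (i : ℤ))) •
        (shifted q N r z c i * shifted q N r z i b) +
      (if c = i then counitDiag q N r d • shifted q N r z c b else 0) +
      (if b = i then counitDiag q N r d • shifted q N r z c b else 0) +
      (if c = i then (if c = b then (counitDiag q N r d * counitDiag q N r b) • (1 : A)
        else 0) else 0) := by
    intro i hi
    have hi' : r < i := by simp only [Finset.mem_Icc] at hi; omega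
    have hw := zpow_mul_counitDiag hq (N := N) hd hi'
    rw [eq_shifted_add q N r z c i, eq_shifted_add q N r z i b, ← hw]
    by_cases h1 : c = i <;> by_cases h2 : b = i
    · subst h1; subst h2
      simp only [if_true, mul_add, add_mul, smul_mul_assoc, mul_smul_comm, one_mul, mul_one]
      module
    · subst h1
      simp only [if_true, if_neg h2, if_neg (Ne.symm h2), mul_add, add_mul, smul_mul_assoc,
        mul_smul_comm, one_mul, mul_one]
      module
    · subst h2
      simp only [if_true, if_neg h1, mul_add, add_mul, smul_mul_assoc,
        mul_smul_comm, one_mul, mul_one]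
      module
    · simp [h1, h2, Ne.symm h2]
  rw [weightedSum, Finset.sum_congr rfl h1, weightedSum]
  simp only [Finset.sum_add_distrib, Finset.sum_ite_eq, Finset.mem_Icc]
  simp only [Finset.mem_Icc] at hb hc
  simp only [hb.2, hc.2, and_true]
  by_cases h3 : c = b
  · subst h3
    by_cases h1 : d ≤ c <;>
      simp only [h1, and_self, and_false, if_true, if_false] <;> module
  · by_cases h1 : d ≤ c <;> by_cases h2 : d ≤ b <;>
      simp only [h1, h2, h3, and_self, false_and, if_true, if_false, ite_self] <;> module

theorem weightedSum_lower (q : ℝ) {N r : ℕ} (z : ℕ → ℕ → A) (b c : ℕ) {d : ℕ} (hd : ¬ r < d) :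
    weightedSum (q : ℂ) z (Finset.Ico 1 d) d c b =
      weightedSum (q : ℂ) (shifted q N r z) (Finset.Ico 1 d) d c b := by
  refine Finset.sum_congr rfl fun i hi => ?_
  have h0 : counitDiag q N r i = 0 := by
    rw [counitDiag, if_neg]; simp only [Finset.mem_Ico] at hi; omega
  have h1 : z c i = shifted q N r z c i := by
    rw [eq_shifted_add q N r z c i]
    by_cases h : c = i
    · subst h; simp [h0]
    · simp [h]
  have h2 : z i b = shifted q N r z i b := by
    rw [eq_shifted_add q N r z i b]; simp [h0]
  rw [h1, h2]

theorem weightedSum_eq_truncatedSum_add {q : ℝ} (hq : q ≠ 0) {N r : ℕ} {z : ℕ → ℕ → A}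
    (h : GrassRels q N r z) {b c d : ℕ} (hb : b ∈ Finset.Icc 1 N) (hc : c ∈ Finset.Icc 1 N)
    (hd : d ∈ Finset.Icc 1 N) :
    weightedSum (q : ℂ) z (Finset.Ico 1 d) d c b =
      truncatedSum (q : ℂ) N r (shifted q N r z) d c b +
      (counitDiag q N r d * ((if b < d then 1 else 0) - (if d ≤ c then 1 else 0))) •
        shifted q N r z c b +
      (if c = b ∧ b < d then counitDiag q N r d * counitDiag q N r b else 0) • (1 : A) := by
  by_cases hr : r < d
  · have hs : weightedSum (q : ℂ) z (Finset.Ico 1 d) d c b +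
        weightedSum (q : ℂ) z (Finset.Icc d N) d c b = counitDiag q N r d • z c b := by
      rw [← weightedSum_full hq h hb hc hr, weightedSum, weightedSum, weightedSum]
      simp only [Finset.mem_Icc] at hd
      rw [← Finset.Ico_add_one_right_eq_Icc, ← Finset.Ico_add_one_right_eq_Icc]
      exact Finset.sum_Ico_consecutive _ hd.1 (by omega)
    rw [eq_sub_of_add_eq hs, weightedSum_upper hq z hb hc hr, truncatedSum, if_pos hr,
      eq_shifted_add q N r z c b]
    by_cases h3 : c = b
    · subst h3
      by_cases h1 : d ≤ c <;>
        simp only [h1, ← not_le, and_self, and_false, not_true, not_false_iff,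
          if_true, if_false] <;> module
    · by_cases h1 : d ≤ c <;> by_cases h2 : d ≤ b <;>
        simp only [h1, h2, h3, ← not_le, false_and, not_true, not_false_iff,
          if_true, if_false] <;> module
  · rw [weightedSum_lower (N := N) q z b c hr, truncatedSum, if_neg hr]
    simp [counitDiag, hr]

/-- Homogeneous quadratic exchange relations for pairs of letters `x_{ij}` that are not in the
order "lower triangular, diagonal, upper triangular". -/
structure ExchangeRels (Q : ℂ) (N r : ℕ) (x : ℕ → ℕ → A) : Prop where
  diag_comm {a c d : ℕ} (ha : a ∈ Finset.Icc 1 N) (hc : c ∈ Finset.Icc 1 N)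
    (hd : d ∈ Finset.Icc 1 N) (h : d < a ∧ d < c ∧ a ≠ c ∨ a < d ∧ c < d ∧ a ≠ c) :
    x d d * x c a = x c a * x d d
  diag_lower {a c d : ℕ} (ha : a ∈ Finset.Icc 1 N) (hc : c ∈ Finset.Icc 1 N)
    (hd : d ∈ Finset.Icc 1 N) (had : a < d) (hdc : d < c) :
    x d d * x c a = x c a * x d d + ((Q - Q⁻¹) * Q) • (x c d * x d a) +
      (Q - Q⁻¹) ^ 2 • truncatedSum Q N r x d c a
  diag_lower_row {a c : ℕ} (ha : a ∈ Finset.Icc 1 N) (hc : c ∈ Finset.Icc 1 N) (hac : a < c) :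
    x c c * x c a = x c a * x c c - ((Q - Q⁻¹) * Q⁻¹) • truncatedSum Q N r x c c a
  diag_lower_col {a c : ℕ} (ha : a ∈ Finset.Icc 1 N) (hc : c ∈ Finset.Icc 1 N) (hac : a < c) :
    x a a * x c a = Q ^ 2 • (x c a * x a a) + ((Q - Q⁻¹) * Q) • truncatedSum Q N r x a c a
  upper_diag {b c d : ℕ} (hb : b ∈ Finset.Icc 1 N) (hc : c ∈ Finset.Icc 1 N)
    (hd : d ∈ Finset.Icc 1 N) (hdc : d < c) (hcb : c < b) :
    x d b * x c c = x c c * x d b + (Q - Q⁻¹) • (x c b * x d c)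
  upper_diag_row {b c : ℕ} (hb : b ∈ Finset.Icc 1 N) (hc : c ∈ Finset.Icc 1 N) (hcb : c < b) :
    Q⁻¹ • (x c b * x c c) = Q • (x c c * x c b) + (Q - Q⁻¹) • truncatedSum Q N r x c c b
  upper_diag_col {b d : ℕ} (hb : b ∈ Finset.Icc 1 N) (hd : d ∈ Finset.Icc 1 N) (hdb : d < b) :
    Q • (x d b * x b b) = Q • (x b b * x d b) - (Q - Q⁻¹) • truncatedSum Q N r x b d b
  upper_lower_row {a b c : ℕ} (ha : a ∈ Finset.Icc 1 N) (hb : b ∈ Finset.Icc 1 N)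
    (hc : c ∈ Finset.Icc 1 N) (hac : a < c) (hcb : c < b) :
    Q⁻¹ • (x c b * x c a) = x c a * x c b
  upper_lower_col {b c d : ℕ} (hb : b ∈ Finset.Icc 1 N) (hc : c ∈ Finset.Icc 1 N)
    (hd : d ∈ Finset.Icc 1 N) (hdb : d < b) (hbc : b < c) :
    x d b * x c b = Q • (x c b * x d b)
  upper_lower {a b c d : ℕ} (ha : a ∈ Finset.Icc 1 N) (hb : b ∈ Finset.Icc 1 N)
    (hc : c ∈ Finset.Icc 1 N) (hd : d ∈ Finset.Icc 1 N) (hdb : d < b) (hac : a < c)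
    (had : a ≠ d) (hbc : b ≠ c) (hcd : c ≠ d) (hab : a ≠ b) :
    x d b * x c a = x c a * x d b +
      (if a < b ∧ d < c then Q - Q⁻¹ else 0) • (x c b * x d a)
  upper_lower_mid_left {a b c : ℕ} (ha : a ∈ Finset.Icc 1 N) (hb : b ∈ Finset.Icc 1 N)
    (hc : c ∈ Finset.Icc 1 N) (hab : a < b) (hac : a < c) (hbc : b ≠ c) :
    x a b * x c a = Q • (x c a * x a b) + (Q - Q⁻¹) • (x c b * x a a) +
      (Q - Q⁻¹) • truncatedSum Q N r x a c b
  upper_lower_mid_right {a b d : ℕ} (ha : a ∈ Finset.Icc 1 N) (hb : b ∈ Finset.Icc 1 N)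
    (hd : d ∈ Finset.Icc 1 N) (hdb : d < b) (hab : a < b) (had : a ≠ d) :
    Q • (x d b * x b a) = x b a * x d b + (Q - Q⁻¹) • (x b b * x d a) -
      (Q - Q⁻¹) • truncatedSum Q N r x b d a
  upper_lower_opp {a b : ℕ} (ha : a ∈ Finset.Icc 1 N) (hb : b ∈ Finset.Icc 1 N) (hab : a < b) :
    Q • (x a b * x b a) = Q • (x b a * x a b) + (Q - Q⁻¹) • (x b b * x a a) +
      (Q - Q⁻¹) • truncatedSum Q N r x a b b - (Q - Q⁻¹) • truncatedSum Q N r x b a a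

theorem exchangeRels_shifted {q : ℝ} (hq : q ≠ 0) {N r : ℕ} {z : ℕ → ℕ → A}
    (h : GrassRels q N r z) : ExchangeRels (q : ℂ) N r (shifted q N r z) := by
  have hq' : (q : ℂ) ≠ 0 := by exact_mod_cast hq
  have key : ∀ {a b c d : ℕ}, a ∈ Finset.Icc 1 N → b ∈ Finset.Icc 1 N →
      c ∈ Finset.Icc 1 N → d ∈ Finset.Icc 1 N → _ :=
    fun {a b c d} ha hb hc hd => by
      have := reflection_equation_explicit h ha hb hc hd
      simp only [weightedSum_eq_truncatedSum_add hq h, ha, hb, hc, hd] at this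
      simp only [eq_shifted_add q N r z] at this
      exact this
  generalize shifted q N r z = x at key ⊢
  generalize counitDiag q N r = e at key
  generalize hT : truncatedSum (q : ℂ) N r x = T at key
  generalize (q : ℂ) = Q at *
  constructor <;> try simp only [hT]
  case' diag_comm =>
    intro a c d ha hc hd h
    have k := key ha hd hc hd
    rcases h with h | h
  case' diag_lower =>
    intro a c d ha hc hd h₁ h₂
    have k := key ha hd hc hd
  case' diag_lower_row =>
    intro a c ha hc h
    have k := key ha hc hc hc
  case' diag_lower_col =>
    intro a c ha hc h
    have k := key ha ha hc ha
  case' upper_diag =>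
    intro b c d hb hc hd h₁ h₂
    have k := key hc hb hc hd
  case' upper_diag_row =>
    intro b c hb hc h
    have k := key hc hb hc hc
  case' upper_diag_col =>
    intro b d hb hd h
    have k := key hb hb hb hd
  case' upper_lower_row =>
    intro a b c ha hb hc h₁ h₂
    have k := key ha hb hc hc
  case' upper_lower_col =>
    intro b c d hb hc hd h₁ h₂
    have k := key hb hb hc hd
  case' upper_lower =>
    intro a b c d ha hb hc hd h₁ h₂ h₃ h₄ h₅ h₆
    have k := key ha hb hc hd
    by_cases h₇ : a < b <;> by_cases h₈ : d < c
  case' upper_lower_mid_left =>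
    intro a b c ha hb hc h₁ h₂ h₃
    have k := key ha hb hc ha
  case' upper_lower_mid_right =>
    intro a b d ha hb hd h₁ h₂ h₃
    have k := key ha hb hb hd
  case' upper_lower_opp =>
    intro a b ha hb h
    have k := key ha hb hb ha
  all_goals first
    | exfalso; omega
    | simp (disch := omega) only [if_pos, if_neg, if_true, true_and] at k ⊢
      simp only [mul_add, add_mul, smul_mul_assoc, mul_smul_comm, one_mul, mul_one] at k
      linear_combination (norm := (match_scalars <;> field_simp <;> ring)) k

theorem truncatedSum_mem {Q : ℂ} {N r : ℕ} {x : ℕ → ℕ → A} {d c b : ℕ} (S : Submodule ℂ A)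
    (h₁ : ∀ i, d ≤ r → 1 ≤ i → i < d → x c i * x i b ∈ S)
    (h₂ : ∀ i, r < d → d ≤ i → i ≤ N → x c i * x i b ∈ S) :
    truncatedSum Q N r x d c b ∈ S := by
  unfold truncatedSum weightedSum
  split_ifs with h
  · refine S.neg_mem (S.sum_mem fun i hi => S.smul_mem _ ?_)
    exact h₂ i h (Finset.mem_Icc.1 hi).1 (Finset.mem_Icc.1 hi).2
  · refine S.sum_mem fun i hi => S.smul_mem _ ?_
    exact h₁ i (not_lt.1 h) (Finset.mem_Ico.1 hi).1 (Finset.mem_Ico.1 hi).2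

theorem truncatedSum_eq_sub {Q : ℂ} {N r : ℕ} {x : ℕ → ℕ → A} {d c b : ℕ} (S : Submodule ℂ A)
    (hr : r < d) (hd : d ≤ N) (h : ∀ i, d < i → i ≤ N → x c i * x i b ∈ S) :
    ∃ s ∈ S, truncatedSum Q N r x d c b = s - x c d * x d b := by
  refine ⟨-weightedSum Q x (Finset.Ioc d N) d c b, S.neg_mem (S.sum_mem fun i hi =>
    S.smul_mem _ (h i (Finset.mem_Ioc.1 hi).1 (Finset.mem_Ioc.1 hi).2)), ?_⟩
  rw [truncatedSum, if_pos hr, weightedSum, ← Finset.Ioc_insert_left hd,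
    Finset.sum_insert (by simp), weightedSum]
  simp only [sub_self, zpow_zero, one_smul]
  abel

/-- The span of the products `x_{ij} x_{kl}` with `j + 1 - i < m` (truncated subtraction). -/
def lowSpan (N : ℕ) (x : ℕ → ℕ → A) (m : ℕ) : Submodule ℂ A :=
  Submodule.span ℂ {y | ∃ i j k l, (i ∈ Finset.Icc 1 N ∧ j ∈ Finset.Icc 1 N) ∧
    (k ∈ Finset.Icc 1 N ∧ l ∈ Finset.Icc 1 N) ∧ j + 1 - i < m ∧ y = x i j * x k l}

theorem lowSpan_mono (N : ℕ) (x : ℕ → ℕ → A) {m n : ℕ} (h : m ≤ n) :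
    lowSpan N x m ≤ lowSpan N x n := by
  refine Submodule.span_mono ?_
  rintro y ⟨i, j, k, l, hij, hkl, hm, rfl⟩
  exact ⟨i, j, k, l, hij, hkl, hm.trans_le h, rfl⟩

theorem mul_mem_lowSpan {N : ℕ} (x : ℕ → ℕ → A) {m i j k l : ℕ} (h : j + 1 - i < m)
    (hi : 1 ≤ i ∧ i ≤ N) (hj : 1 ≤ j ∧ j ≤ N) (hk : 1 ≤ k ∧ k ≤ N) (hl : 1 ≤ l ∧ l ≤ N) :
    x i j * x k l ∈ lowSpan N x m :=
  Submodule.subset_span ⟨i, j, k, l, by simp only [Finset.mem_Icc]; omega,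
    by simp only [Finset.mem_Icc]; omega, h, rfl⟩

namespace ExchangeRels

variable {Q : ℂ} {N r : ℕ} {x : ℕ → ℕ → A}

theorem upper_lower_mem_one (H : ExchangeRels Q N r x) (hQ : Q ≠ 0) {a b c : ℕ} (ha : 1 ≤ a)
    (hac : a < c) (hcb : c < b) (hrb : r < b) (hb : b ≤ N) :
    x c b * x b a ∈ lowSpan N x 1 := by
  induction hn : N - b using Nat.strong_induction_on generalizing b with
  | _ n ih =>
    have k := H.upper_lower_mid_right (a := a) (b := b) (d := c)
      (by simp; omega) (by simp; omega) (by simp; omega) (by omega) (by omega) (by omega)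
    rw [H.diag_comm (by simp; omega) (by simp; omega) (by simp; omega) (by omega)] at k
    obtain ⟨s, hs, e⟩ := truncatedSum_eq_sub (Q := Q) (x := x) (c := c) (b := a)
      (lowSpan N x 1) hrb hb (fun i hi hi' => ih (N - i) (by omega) (by omega) (by omega) hi' rfl)
    rw [e] at k
    have k' : Q⁻¹ • (x c b * x b a) =
        x b a * x c b + (Q - Q⁻¹) • (x c a * x b b) - (Q - Q⁻¹) • s := by
      linear_combination (norm := (match_scalars <;> field_simp <;> ring)) k
    refine (Submodule.smul_mem_iff _ (inv_ne_zero hQ)).1 (k' ▸ ?_)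
    refine Submodule.sub_mem _ (Submodule.add_mem _ ?_ (Submodule.smul_mem _ _ ?_))
      (Submodule.smul_mem _ _ hs) <;>
    exact mul_mem_lowSpan x (by omega) (by omega) (by omega) (by omega) (by omega)

theorem upper_lower_mem_two (H : ExchangeRels Q N r x) (hQ : Q ≠ 0) {a b d : ℕ} (ha : 1 ≤ a)
    (hd : 1 ≤ d) (hab : a < b) (hdb : d < b) (hrb : r < b) (hb : b ≤ N) :
    x d b * x b a ∈ lowSpan N x 2 := by
  induction hn : N - b using Nat.strong_induction_on generalizing a b d with
  | _ n ih =>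
    obtain ⟨s, hs, e⟩ := truncatedSum_eq_sub (Q := Q) (x := x) (c := d) (b := a)
      (lowSpan N x 2) hrb hb
      (fun i hi hi' => ih (N - i) (by omega) ha hd (by omega) (by omega) (by omega) hi' rfl)
    by_cases had : a = d
    · subst had
      have k := H.upper_lower_opp (a := a) (b := b) (by simp; omega) (by simp; omega) hab
      rw [e] at k
      have hT : truncatedSum Q N r x a b b ∈ lowSpan N x 2 := by
        refine truncatedSum_mem _ (fun i _ hi hia => mul_mem_lowSpan x (by omega) (by omega)
          (by omega) (by omega) (by omega)) fun i hra hai hi => ?_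
        rcases le_or_gt i b with hib | hib
        · exact mul_mem_lowSpan x (by omega) (by omega) (by omega) (by omega) (by omega)
        · exact ih (N - i) (by omega) (by omega) (by omega) hib hib (by omega) hi rfl
      have k' : Q⁻¹ • (x a b * x b a) =
          Q • (x b a * x a b) + (Q - Q⁻¹) • (x b b * x a a) +
            (Q - Q⁻¹) • truncatedSum Q N r x a b b - (Q - Q⁻¹) • s := by
        linear_combination (norm := (match_scalars <;> field_simp <;> ring)) k
      refine (Submodule.smul_mem_iff _ (inv_ne_zero hQ)).1 (k' ▸ ?_)
      refine Submodule.sub_mem _ (Submodule.add_mem _ (Submodule.add_mem _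
        (Submodule.smul_mem _ _ ?_) (Submodule.smul_mem _ _ ?_)) (Submodule.smul_mem _ _ hT))
        (Submodule.smul_mem _ _ hs) <;>
      exact mul_mem_lowSpan x (by omega) (by omega) (by omega) (by omega) (by omega)
    · have k := H.upper_lower_mid_right (a := a) (b := b) (d := d)
        (by simp; omega) (by simp; omega) (by simp; omega) hdb hab had
      rw [e] at k
      have k' : Q⁻¹ • (x d b * x b a) =
          x b a * x d b + (Q - Q⁻¹) • (x b b * x d a) - (Q - Q⁻¹) • s := by
        linear_combination (norm := (match_scalars <;> field_simp <;> ring)) k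
      refine (Submodule.smul_mem_iff _ (inv_ne_zero hQ)).1 (k' ▸ ?_)
      refine Submodule.sub_mem _ (Submodule.add_mem _ ?_ (Submodule.smul_mem _ _ ?_))
        (Submodule.smul_mem _ _ hs) <;>
      exact mul_mem_lowSpan x (by omega) (by omega) (by omega) (by omega) (by omega)

theorem diag_lower_row_mem (H : ExchangeRels Q N r x) (hQ : Q ≠ 0) {a c : ℕ} (ha : 1 ≤ a)
    (hac : a < c) (hc : c ≤ N) :
    x c c * x c a ∈ lowSpan N x 1 := by
  have k := H.diag_lower_row (a := a) (c := c) (by simp; omega) (by simp; omega) hac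
  have hm : x c a * x c c ∈ lowSpan N x 1 :=
    mul_mem_lowSpan x (by omega) (by omega) (by omega) (by omega) (by omega)
  rcases le_or_gt c r with hr | hr
  · rw [k]
    refine Submodule.sub_mem _ hm (Submodule.smul_mem _ _ (truncatedSum_mem _
      (fun i _ hi hic => mul_mem_lowSpan x (by omega) (by omega) (by omega) (by omega)
        (by omega)) fun i h => by omega))
  · obtain ⟨s, hs, e⟩ := truncatedSum_eq_sub (Q := Q) (x := x) (c := c) (b := a)
      (lowSpan N x 1) hr hc
      (fun i hi hi' => H.upper_lower_mem_one hQ ha hac hi (by omega) hi')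
    rw [e] at k
    have k' : (Q⁻¹ ^ 2) • (x c c * x c a) = x c a * x c c - ((Q - Q⁻¹) * Q⁻¹) • s := by
      linear_combination (norm := (match_scalars <;> field_simp <;> ring)) k
    refine (Submodule.smul_mem_iff _ (pow_ne_zero 2 (inv_ne_zero hQ))).1 (k' ▸ ?_)
    exact Submodule.sub_mem _ hm (Submodule.smul_mem _ _ hs)

theorem truncatedSum_mem_one (H : ExchangeRels Q N r x) (hQ : Q ≠ 0) {a c d : ℕ} (ha : 1 ≤ a)
    (had : a ≤ d) (hdc : d < c) (hc : c ≤ N) :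
    truncatedSum Q N r x d c a ∈ lowSpan N x 1 := by
  refine truncatedSum_mem _ (fun i _ hi hid => mul_mem_lowSpan x (by omega) (by omega)
    (by omega) (by omega) (by omega)) fun i hrd hdi hi => ?_
  rcases lt_trichotomy i c with h | rfl | h
  · exact mul_mem_lowSpan x (by omega) (by omega) (by omega) (by omega) (by omega)
  · exact H.diag_lower_row_mem hQ ha (by omega) hc
  · exact H.upper_lower_mem_one hQ ha (by omega) h (by omega) hi

theorem diag_lower_mem (H : ExchangeRels Q N r x) (hQ : Q ≠ 0) {a c d : ℕ} (ha : 1 ≤ a)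
    (hac : a < c) (hc : c ≤ N) (hd : 1 ≤ d ∧ d ≤ N) :
    x d d * x c a ∈ lowSpan N x 1 := by
  have hm : x c a * x d d ∈ lowSpan N x 1 :=
    mul_mem_lowSpan x (by omega) (by omega) (by omega) (by omega) (by omega)
  by_cases h₁ : d < a ∨ c < d
  · rwa [H.diag_comm (by simp; omega) (by simp; omega) (by simp; omega) (by omega)]
  by_cases h₂ : d = c
  · subst h₂
    exact H.diag_lower_row_mem hQ ha hac hc
  by_cases h₃ : d = a
  · subst h₃
    rw [H.diag_lower_col (by simp; omega) (by simp; omega) hac]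
    exact Submodule.add_mem _ (Submodule.smul_mem _ _ hm)
      (Submodule.smul_mem _ _ (H.truncatedSum_mem_one hQ ha le_rfl hac hc))
  · rw [H.diag_lower (by simp; omega) (by simp; omega) (by simp; omega) (by omega) (by omega)]
    refine Submodule.add_mem _ (Submodule.add_mem _ hm (Submodule.smul_mem _ _ ?_))
      (Submodule.smul_mem _ _ (H.truncatedSum_mem_one hQ ha (by omega) (by omega) hc))
    exact mul_mem_lowSpan x (by omega) (by omega) (by omega) (by omega) (by omega)

theorem upper_diag_col_mem (H : ExchangeRels Q N r x) (hQ : Q ≠ 0) {b d : ℕ} (hd : 1 ≤ d)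
    (hdb : d < b) (hb : b ≤ N) :
    x d b * x b b ∈ lowSpan N x (b + 1 - d) := by
  have k := H.upper_diag_col (b := b) (d := d) (by simp; omega) (by simp; omega) hdb
  have hm : x b b * x d b ∈ lowSpan N x (b + 1 - d) :=
    mul_mem_lowSpan x (by omega) (by omega) (by omega) (by omega) (by omega)
  rcases le_or_gt b r with hr | hr
  · refine (Submodule.smul_mem_iff _ hQ).1 (k ▸ ?_)
    refine Submodule.sub_mem _ (Submodule.smul_mem _ _ hm)
      (Submodule.smul_mem _ _ (truncatedSum_mem _
      (fun i _ hi hic => mul_mem_lowSpan x (by omega) (by omega) (by omega) (by omega)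
        (by omega)) fun i h => by omega))
  · obtain ⟨s, hs, e⟩ := truncatedSum_eq_sub (Q := Q) (x := x) (c := d) (b := b)
      (lowSpan N x (b + 1 - d)) hr hb
      (fun i hi hi' => lowSpan_mono N x (by omega)
        (H.upper_lower_mem_two hQ (by omega) hd hi (by omega) (by omega) hi'))
    rw [e] at k
    have k' : Q⁻¹ • (x d b * x b b) = Q • (x b b * x d b) - (Q - Q⁻¹) • s := by
      linear_combination (norm := (match_scalars <;> field_simp <;> ring)) k
    refine (Submodule.smul_mem_iff _ (inv_ne_zero hQ)).1 (k' ▸ ?_)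
    exact Submodule.sub_mem _ (Submodule.smul_mem _ _ hm) (Submodule.smul_mem _ _ hs)

theorem upper_diag_mem (H : ExchangeRels Q N r x) (hQ : Q ≠ 0) {b c d : ℕ} (hd : 1 ≤ d)
    (hdb : d < b) (hb : b ≤ N) (hc : 1 ≤ c ∧ c ≤ N) :
    x d b * x c c ∈ lowSpan N x (b + 1 - d) := by
  have hm : x c c * x d b ∈ lowSpan N x (b + 1 - d) :=
    mul_mem_lowSpan x (by omega) (by omega) (by omega) (by omega) (by omega)
  by_cases h₁ : c < d ∨ b < c
  · rwa [← H.diag_comm (by simp; omega) (by simp; omega) (by simp; omega) (by omega)]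
  by_cases h₂ : c = b
  · subst h₂
    exact H.upper_diag_col_mem hQ hd hdb hb
  by_cases h₃ : c = d
  · subst h₃
    have k := H.upper_diag_row (b := b) (c := c) (by simp; omega) (by simp; omega) hdb
    refine (Submodule.smul_mem_iff _ (inv_ne_zero hQ)).1 (k ▸ ?_)
    refine Submodule.add_mem _ (Submodule.smul_mem _ _ hm)
      (Submodule.smul_mem _ _ (truncatedSum_mem _
      (fun i _ hi hic => mul_mem_lowSpan x (by omega) (by omega) (by omega) (by omega)
        (by omega)) fun i hrc hci hi => ?_))
    rcases lt_trichotomy i b with h | rfl | h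
    · exact mul_mem_lowSpan x (by omega) (by omega) (by omega) (by omega) (by omega)
    · exact H.upper_diag_col_mem hQ hd hdb hb
    · exact lowSpan_mono N x (by omega)
        (H.upper_lower_mem_two hQ (by omega) hd h (by omega) (by omega) hi)
  · rw [H.upper_diag (by simp; omega) (by simp; omega) (by simp; omega) (by omega) (by omega)]
    refine Submodule.add_mem _ hm (Submodule.smul_mem _ _ ?_)
    exact mul_mem_lowSpan x (by omega) (by omega) (by omega) (by omega) (by omega)

theorem upper_lower_mem (H : ExchangeRels Q N r x) (hQ : Q ≠ 0) {a b c d : ℕ} (ha : 1 ≤ a)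
    (hac : a < c) (hc : c ≤ N) (hd : 1 ≤ d) (hdb : d < b) (hb : b ≤ N) :
    x d b * x c a ∈ lowSpan N x (b + 1 - d) := by
  have hm : x c a * x d b ∈ lowSpan N x (b + 1 - d) :=
    mul_mem_lowSpan x (by omega) (by omega) (by omega) (by omega) (by omega)
  rcases eq_or_ne b c with rfl | hbc
  · rcases lt_or_ge r b with hr | hr
    · exact lowSpan_mono N x (by omega) (H.upper_lower_mem_two hQ ha hd hac hdb hr hb)
    have hT : truncatedSum Q N r x b d a ∈ lowSpan N x (b + 1 - d) :=
      truncatedSum_mem _ (fun i _ hi hib => mul_mem_lowSpan x (by omega) (by omega) (by omega)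
        (by omega) (by omega)) fun i h => by omega
    refine (Submodule.smul_mem_iff _ hQ).1 ?_
    rcases eq_or_ne a d with rfl | had
    · rw [H.upper_lower_opp (by simp; omega) (by simp; omega) hac]
      refine Submodule.sub_mem _ (Submodule.add_mem _ (Submodule.add_mem _
        (Submodule.smul_mem _ _ hm) (Submodule.smul_mem _ _ ?_)) (Submodule.smul_mem _ _ ?_))
        (Submodule.smul_mem _ _ hT)
      · exact mul_mem_lowSpan x (by omega) (by omega) (by omega) (by omega) (by omega)
      · exact truncatedSum_mem _ (fun i _ hi hib => mul_mem_lowSpan x (by omega) (by omega)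
          (by omega) (by omega) (by omega)) fun i h => by omega
    · rw [H.upper_lower_mid_right (by simp; omega) (by simp; omega) (by simp; omega) hdb hac had]
      refine Submodule.sub_mem _ (Submodule.add_mem _ hm (Submodule.smul_mem _ _ ?_))
        (Submodule.smul_mem _ _ hT)
      exact mul_mem_lowSpan x (by omega) (by omega) (by omega) (by omega) (by omega)
  rcases eq_or_ne a d with rfl | had
  · rw [H.upper_lower_mid_left (by simp; omega) (by simp; omega) (by simp; omega) hdb hac hbc]
    refine Submodule.add_mem _ (Submodule.add_mem _ (Submodule.smul_mem _ _ hm)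
      (Submodule.smul_mem _ _ ?_)) (Submodule.smul_mem _ _ (truncatedSum_mem _
      (fun i _ hi hia => ?_) fun i hra hai hi => ?_))
    · exact mul_mem_lowSpan x (by omega) (by omega) (by omega) (by omega) (by omega)
    · exact mul_mem_lowSpan x (by omega) (by omega) (by omega) (by omega) (by omega)
    · by_cases h : i ≤ b ∨ i ≤ c
      · exact mul_mem_lowSpan x (by omega) (by omega) (by omega) (by omega) (by omega)
      · exact lowSpan_mono N x (by omega) (H.upper_lower_mem_two hQ (by omega) (by omega)
          (by omega) (by omega) (by omega) hi)
  rcases eq_or_ne c d with rfl | hcd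
  · refine (Submodule.smul_mem_iff _ (inv_ne_zero hQ)).1 ?_
    rwa [H.upper_lower_row (by simp; omega) (by simp; omega) (by simp; omega) hac hdb]
  rcases eq_or_ne a b with rfl | hab
  · rw [H.upper_lower_col (by simp; omega) (by simp; omega) (by simp; omega) hdb hac]
    exact Submodule.smul_mem _ _ hm
  · rw [H.upper_lower (by simp; omega) (by simp; omega) (by simp; omega) (by simp; omega)
      hdb hac had hbc hcd hab]
    refine Submodule.add_mem _ hm ?_
    split_ifs with h
    · exact Submodule.smul_mem _ _
        (mul_mem_lowSpan x (by omega) (by omega) (by omega) (by omega) (by omega))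
    · simp

end ExchangeRels

/-- The product of the letters `x_{ij}` of a word of index pairs. -/
def wordProd (x : ℕ → ℕ → A) (w : List (ℕ × ℕ)) : A :=
  (w.map fun p => x p.1 p.2).prod

theorem wordProd_append (x : ℕ → ℕ → A) (v w : List (ℕ × ℕ)) :
    wordProd x (v ++ w) = wordProd x v * wordProd x w := by
  simp [wordProd]

/-- All index pairs of the word lie in `{1, …, N}²`. -/
def IsWord (N : ℕ) (w : List (ℕ × ℕ)) : Prop :=
  ∀ p ∈ w, (1 ≤ p.1 ∧ p.1 ≤ N) ∧ (1 ≤ p.2 ∧ p.2 ≤ N)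

theorem isWord_append {N : ℕ} {v w : List (ℕ × ℕ)} :
    IsWord N (v ++ w) ↔ IsWord N v ∧ IsWord N w :=
  List.forall_mem_append

theorem isWord_cons {N : ℕ} {p : ℕ × ℕ} {w : List (ℕ × ℕ)} :
    IsWord N (p :: w) ↔ ((1 ≤ p.1 ∧ p.1 ≤ N) ∧ (1 ≤ p.2 ∧ p.2 ≤ N)) ∧ IsWord N w :=
  List.forall_mem_cons

/-- The span of the standard monomials of length `n`. -/
def standardSpan (N : ℕ) (x : ℕ → ℕ → A) (n : ℕ) : Submodule ℂ A :=
  Submodule.span ℂ {y | ∃ (lm : List (ℕ × ℕ)) (l0 : List ℕ) (lp : List (ℕ × ℕ)),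
    (∀ p ∈ lm, 1 ≤ p.1 ∧ p.1 ≤ N ∧ 1 ≤ p.2 ∧ p.2 ≤ N ∧ p.2 < p.1) ∧
    (∀ i ∈ l0, 1 ≤ i ∧ i ≤ N) ∧
    (∀ p ∈ lp, 1 ≤ p.1 ∧ p.1 ≤ N ∧ 1 ≤ p.2 ∧ p.2 ≤ N ∧ p.1 < p.2) ∧
    lm.length + l0.length + lp.length = n ∧
    y = wordProd x lm * (l0.map fun i => x i i).prod * wordProd x lp}

/-- A word read as a number in base `N + 2`, the letter `(i, j)` having digit `j + 1 - i`. -/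
def wordValue (N : ℕ) : List (ℕ × ℕ) → ℕ
  | [] => 0
  | p :: w => (p.2 + 1 - p.1) * (N + 2) ^ w.length + wordValue N w

theorem wordValue_append (N : ℕ) (v w : List (ℕ × ℕ)) :
    wordValue N (v ++ w) = wordValue N v * (N + 2) ^ w.length + wordValue N w := by
  induction v with
  | nil => simp [wordValue]
  | cons p v ih =>
    simp only [List.cons_append, wordValue, ih, List.length_append]
    ring

theorem wordValue_lt {N : ℕ} {w : List (ℕ × ℕ)} (hw : IsWord N w) :
    wordValue N w < (N + 2) ^ w.length := by
  induction w with
  | nil => simp [wordValue]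
  | cons p w ih =>
    obtain ⟨hp, hw⟩ := isWord_cons.1 hw
    have h : (p.2 + 1 - p.1) * (N + 2) ^ w.length ≤ (N + 1) * (N + 2) ^ w.length :=
      Nat.mul_le_mul_right _ (by omega)
    have := ih hw
    rw [wordValue, List.length_cons, pow_succ]
    linarith

theorem wordValue_cons_lt {N : ℕ} {u p : ℕ × ℕ} {v w : List (ℕ × ℕ)} (hw : IsWord N w)
    (hl : v.length = w.length) (h : p.2 + 1 - p.1 < u.2 + 1 - u.1) :
    wordValue N (p :: w) < wordValue N (u :: v) := by
  have h1 := wordValue_lt hw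
  have h2 : (p.2 + 1 - p.1 + 1) * (N + 2) ^ w.length ≤ (u.2 + 1 - u.1) * (N + 2) ^ w.length :=
    Nat.mul_le_mul_right _ h
  rw [wordValue, wordValue, hl]
  linarith

/-- The letter `u` may not be followed by `v` in a word in the order "lower triangular,
diagonal, upper triangular". -/
def IsDescent (u v : ℕ × ℕ) : Prop :=
  u.1 < u.2 ∧ v.2 ≤ v.1 ∨ u.1 = u.2 ∧ v.2 < v.1

theorem standard_or_descent (w : List (ℕ × ℕ)) :
    (∃ (lm : List (ℕ × ℕ)) (l0 : List ℕ) (lp : List (ℕ × ℕ)),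
      (∀ p ∈ lm, p.2 < p.1) ∧ (∀ p ∈ lp, p.1 < p.2) ∧
      w = lm ++ (l0.map fun i => (i, i)) ++ lp) ∨
    ∃ v₁ u v v₂, IsDescent u v ∧ w = v₁ ++ u :: v :: v₂ := by
  induction w with
  | nil => exact Or.inl ⟨[], [], [], by simp⟩
  | cons u w ih =>
    rcases ih with ⟨lm, l0, lp, hm, hp, rfl⟩ | ⟨v₁, u', v, v₂, h, rfl⟩
    · rcases lt_trichotomy u.2 u.1 with h | h | h
      · exact Or.inl ⟨u :: lm, l0, lp, List.forall_mem_cons.2 ⟨h, hm⟩, hp, by simp⟩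
      · cases lm with
        | nil =>
          refine Or.inl ⟨[], u.1 :: l0, lp, by simp, hp, ?_⟩
          simp only [List.nil_append, List.map_cons, List.cons_append, List.cons.injEq, and_true]
          exact Prod.ext rfl h
        | cons v lm =>
          exact Or.inr ⟨[], u, v, _, Or.inr ⟨h.symm, hm v (by simp)⟩, rfl⟩
      · cases lm with
        | nil =>
          cases l0 with
          | nil => exact Or.inl ⟨[], [], u :: lp, by simp, List.forall_mem_cons.2 ⟨h, hp⟩, rfl⟩
          | cons i l0 => exact Or.inr ⟨[], u, (i, i), _, Or.inl ⟨h, le_rfl⟩, rfl⟩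
        | cons v lm =>
          exact Or.inr ⟨[], u, v, _, Or.inl ⟨h, (hm v (by simp)).le⟩, rfl⟩
    · exact Or.inr ⟨u :: v₁, u', v, v₂, h, rfl⟩

namespace ExchangeRels

variable {Q : ℂ} {N r : ℕ} {x : ℕ → ℕ → A}

theorem descent_mem (H : ExchangeRels Q N r x) (hQ : Q ≠ 0) {u v : ℕ × ℕ} (h : IsDescent u v)
    (hw : IsWord N [u, v]) : x u.1 u.2 * x v.1 v.2 ∈ lowSpan N x (u.2 + 1 - u.1) := by
  obtain ⟨i, j⟩ := u
  obtain ⟨k, l⟩ := v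
  simp only [isWord_cons] at hw
  simp only [IsDescent] at h ⊢
  rcases h with ⟨h₁, h₂⟩ | ⟨rfl, h₂⟩
  · rcases h₂.eq_or_lt with rfl | h₂
    · exact H.upper_diag_mem hQ (by omega) h₁ (by omega) (by omega)
    · exact H.upper_lower_mem hQ (by omega) h₂ (by omega) (by omega) h₁ (by omega)
  · rw [Nat.add_sub_cancel_left]
    exact H.diag_lower_mem hQ (by omega) h₂ (by omega) (by omega)

theorem wordProd_mem_standardSpan (H : ExchangeRels Q N r x) (hQ : Q ≠ 0) {w : List (ℕ × ℕ)}
    (hw : IsWord N w) : wordProd x w ∈ standardSpan N x w.length := by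
  induction hn : wordValue N w using Nat.strong_induction_on generalizing w with
  | _ n ih =>
    rcases standard_or_descent w with ⟨lm, l0, lp, hm, hp, rfl⟩ | ⟨v₁, u, v, v₂, h, rfl⟩
    · simp only [isWord_append] at hw
      refine Submodule.subset_span ⟨lm, l0, lp, fun p h => ?_, fun i h => ?_, fun p h => ?_,
        by simp [add_assoc], ?_⟩
      · have := hw.1.1 p h
        have := hm p h
        omega
      · exact (hw.1.2 (i, i) (List.mem_map.2 ⟨i, h, rfl⟩)).1
      · have := hw.2 p h
        have := hp p h
        omega
      · rw [wordProd_append, wordProd_append]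
        simp [wordProd, Function.comp_def]
    · have hw' := isWord_append.1 hw
      obtain ⟨hu, hv, h₂⟩ : _ ∧ _ ∧ IsWord N v₂ := by simpa only [isWord_cons] using hw'.2
      have huv : x u.1 u.2 * x v.1 v.2 ∈ lowSpan N x (u.2 + 1 - u.1) :=
        H.descent_mem hQ h (isWord_cons.2 ⟨hu, isWord_cons.2 ⟨hv, by simp [IsWord]⟩⟩)
      have hmul : ∀ y ∈ lowSpan N x (u.2 + 1 - u.1), wordProd x v₁ * y * wordProd x v₂ ∈
          standardSpan N x (v₁ ++ u :: v :: v₂).length := by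
        intro y hy
        induction hy using Submodule.span_induction with
        | mem y hy =>
          obtain ⟨i, j, k, l, hij, hkl, hlt, rfl⟩ := hy
          simp only [Finset.mem_Icc] at hij hkl
          have hkl₂ : IsWord N ((k, l) :: v₂) := isWord_cons.2 ⟨hkl, h₂⟩
          have := ih (wordValue N (v₁ ++ (i, j) :: (k, l) :: v₂)) (by
            rw [← hn, wordValue_append, wordValue_append]
            exact Nat.add_lt_add_left
              (wordValue_cons_lt (p := (i, j)) (u := u) (v := v :: v₂) hkl₂ rfl hlt) _)
            (isWord_append.2 ⟨hw'.1, isWord_cons.2 ⟨hij, hkl₂⟩⟩) rfl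
          rw [wordProd_append] at this
          simpa [wordProd, mul_assoc] using this
        | zero => simp
        | add y y' _ _ hy hy' =>
          rw [mul_add, add_mul]
          exact Submodule.add_mem _ hy hy'
        | smul c y _ hy =>
          rw [mul_smul_comm, smul_mul_assoc]
          exact Submodule.smul_mem _ _ hy
      rw [wordProd_append]
      simpa [wordProd, mul_assoc] using hmul _ huv

end ExchangeRels

/-- The span of the products of at least `n` letters. -/
def wordSpan (N : ℕ) (x : ℕ → ℕ → A) (n : ℕ) : Submodule ℂ A :=
  Submodule.span ℂ {y | ∃ w : List (ℕ × ℕ), IsWord N w ∧ n ≤ w.length ∧ y = wordProd x w}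

theorem wordProd_mem_wordSpan {N n : ℕ} (x : ℕ → ℕ → A) {w : List (ℕ × ℕ)} (hw : IsWord N w)
    (h : n ≤ w.length) : wordProd x w ∈ wordSpan N x n :=
  Submodule.subset_span ⟨w, hw, h, rfl⟩

theorem wordSpan_antitone (N : ℕ) (x : ℕ → ℕ → A) : Antitone (wordSpan N x) := by
  refine fun m n h => Submodule.span_mono ?_
  rintro y ⟨w, hw, hn, rfl⟩
  exact ⟨w, hw, h.trans hn, rfl⟩

theorem wordSpan_mul_le (N : ℕ) (x : ℕ → ℕ → A) (m n : ℕ) :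
    wordSpan N x m * wordSpan N x n ≤ wordSpan N x (m + n) := by
  rw [wordSpan, wordSpan, Submodule.span_mul_span, Submodule.span_le]
  rintro _ ⟨_, ⟨v, hv, hm, rfl⟩, _, ⟨w, hw, hn, rfl⟩, rfl⟩
  simp only [SetLike.mem_coe, ← wordProd_append]
  exact wordProd_mem_wordSpan x (isWord_append.2 ⟨hv, hw⟩) (by simp; omega)

theorem pow_le_wordSpan {N : ℕ} {x : ℕ → ℕ → A} {S : Submodule ℂ A} (hS : S ≤ wordSpan N x 1)
    (n : ℕ) : S ^ n ≤ wordSpan N x n := by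
  induction n with
  | zero =>
    rw [pow_zero, Submodule.one_le]
    exact wordProd_mem_wordSpan (w := []) x (by simp [IsWord]) le_rfl
  | succ n ih =>
    rw [pow_succ]
    exact (mul_le_mul' ih hS).trans (wordSpan_mul_le N x n 1)

end ReflectionEquation

namespace QGrassData

variable {q : ℝ} {N r : ℕ} (G : QGrassData q N r)

theorem counit_z_self {i : ℕ} (hi : i ∈ Finset.Icc 1 N) :
    G.counit (G.z i i) = counitDiag q N r i := by
  simp [G.counit_z i hi i hi, counitDiag]

theorem z_sub_counit {i j : ℕ} (hi : i ∈ Finset.Icc 1 N) (hj : j ∈ Finset.Icc 1 N) :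
    G.z i j - algebraMap ℂ G.B (G.counit (G.z i j)) = shifted q N r G.z i j := by
  by_cases h : i = j
  · subst h
    rw [G.counit_z_self hi, shifted, if_pos rfl]
  · rw [G.counit_z i hi j hj, if_neg fun h' => h h'.1, shifted, if_neg h, map_zero, sub_zero]

theorem sub_counit_mem_wordSpan (y : G.B) :
    y - algebraMap ℂ G.B (G.counit y) ∈ wordSpan N (shifted q N r G.z) 1 := by
  have hy : y ∈ Algebra.adjoin ℂ
      {x : G.B | ∃ i ∈ Finset.Icc 1 N, ∃ j ∈ Finset.Icc 1 N, x = G.z i j} := by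
    rw [G.gen]; trivial
  induction hy using Algebra.adjoin_induction with
  | mem y hy =>
    obtain ⟨i, hi, j, hj, rfl⟩ := hy
    rw [G.z_sub_counit hi hj]
    have := wordProd_mem_wordSpan (N := N) (n := 1) (shifted q N r G.z) (w := [(i, j)])
      (by simpa [IsWord] using And.intro hi hj) le_rfl
    simpa [wordProd] using this
  | algebraMap c => simp
  | add y y' _ _ hy hy' =>
    have := Submodule.add_mem _ hy hy'
    rwa [sub_add_sub_comm, ← map_add, ← map_add] at this
  | mul y y' _ _ hy hy' =>
    have h' : (y - algebraMap ℂ G.B (G.counit y)) * (y' - algebraMap ℂ G.B (G.counit y')) ∈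
        wordSpan N (shifted q N r G.z) 1 :=
      wordSpan_antitone N _ one_le_two
        (wordSpan_mul_le N _ 1 1 (Submodule.mul_mem_mul hy hy'))
    rw [show y * y' - algebraMap ℂ G.B (G.counit (y * y')) =
        (y - algebraMap ℂ G.B (G.counit y)) * (y' - algebraMap ℂ G.B (G.counit y')) +
        G.counit y' • (y - algebraMap ℂ G.B (G.counit y)) +
        G.counit y • (y' - algebraMap ℂ G.B (G.counit y')) from by
      simp only [Algebra.algebraMap_eq_smul_one, mul_sub, sub_mul, map_mul, smul_mul_assoc,
        mul_smul_comm, one_mul, mul_one]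
      module]
    exact Submodule.add_mem _ (Submodule.add_mem _ h' (Submodule.smul_mem _ _ hy))
      (Submodule.smul_mem _ _ hy')

theorem Bp_le_wordSpan : G.Bp ≤ wordSpan N (shifted q N r G.z) 1 := by
  intro y hy
  have := G.sub_counit_mem_wordSpan y
  rwa [show G.counit y = 0 from hy, map_zero, sub_zero] at this

end QGrassData

/-- Lemma `feps2k=0`.  Let `k ∈ ℕ` and let `f ∈ B°` be a functional
vanishing on every monomial
`x = x_{-,1}⋯x_{-,k₋} · x⁺_{0,1}⋯x⁺_{0,k₀} · x_{+,1}⋯x_{+,k₊}` with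
`k₋ + k₀ + k₊ ≥ k`, where the `x_{-,l}` are generators `z_{ij}` (`i > j`), the
`x⁺_{0,l}` are elements `z_{ii} - ε(z_{ii})`, and the `x_{+,l}` are generators `z_{ij}`
(`i < j`).  Then `f` vanishes on `(B⁺)^{2k}`. -/
theorem vanishing_on_standard_monomials_implies_vanishing_on_Bplus_pow
    (q : ℝ) (hq₁ : q ≠ -1) (hq₂ : q ≠ 0) (hq₃ : q ≠ 1)
    (N r : ℕ) (hN : 2 ≤ N) (hr1 : 1 ≤ r) (hr2 : r ≤ N - 1)
    (G : QGrassData q N r) (k : ℕ)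
    (f : G.B →ₗ[ℂ] ℂ) (hf : IsDualCoalgebraElem G f)
    (hvan : ∀ (lm : List (ℕ × ℕ)) (l0 : List ℕ) (lp : List (ℕ × ℕ)),
      (∀ p ∈ lm, 1 ≤ p.1 ∧ p.1 ≤ N ∧ 1 ≤ p.2 ∧ p.2 ≤ N ∧ p.2 < p.1) →
      (∀ i ∈ l0, 1 ≤ i ∧ i ≤ N) →
      (∀ p ∈ lp, 1 ≤ p.1 ∧ p.1 ≤ N ∧ 1 ≤ p.2 ∧ p.2 ≤ N ∧ p.1 < p.2) →
      k ≤ lm.length + l0.length + lp.length →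
      f ((lm.map fun p => G.z p.1 p.2).prod *
         (l0.map fun i => G.z i i - algebraMap ℂ G.B (G.counit (G.z i i))).prod *
         (lp.map fun p => G.z p.1 p.2).prod) = 0) :
    ∀ y ∈ G.Bp ^ (2 * k), f y = 0 := by
  have hQ : (q : ℂ) ≠ 0 := by exact_mod_cast hq₂
  have H := exchangeRels_shifted hq₂ G.rels
  have hstd : ∀ n, k ≤ n → ∀ y ∈ standardSpan N (shifted q N r G.z) n, f y = 0 := by
    intro n hn y hy
    refine (Submodule.span_le (p := LinearMap.ker f)).2 ?_ hy
    rintro _ ⟨lm, l0, lp, hm, h0, hp, rfl, rfl⟩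
    have := hvan lm l0 lp hm h0 hp hn
    rw [List.map_congr_left fun p h => eq_shifted_of_ne q N r G.z (hm p h).2.2.2.2.ne',
      List.map_congr_left fun i h => G.z_sub_counit (Finset.mem_Icc.2 (h0 i h))
        (Finset.mem_Icc.2 (h0 i h)),
      List.map_congr_left fun p h => eq_shifted_of_ne q N r G.z (hp p h).2.2.2.2.ne] at this
    exact this
  intro y hy
  refine (Submodule.span_le (p := LinearMap.ker f)).2 ?_
    (pow_le_wordSpan G.Bp_le_wordSpan (2 * k) hy)
  rintro _ ⟨w, hw, hn, rfl⟩
  exact hstd w.length (by omega) _ (H.wordProd_mem_standardSpan hQ hw)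
end
end
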